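/- For every integer n ≥ 13 there is no finite-volume right-angled convex hyperbolic n-polyhedron. -/

import Mathlib

open scoped BigOperators

noncomputable section

/-- The Minkowski bilinear form `⟨x,y⟩ = -x₀y₀ + x₁y₁ + ⋯ + xₙyₙ` on `ℝ^{n+1}`. -/
def mink {n : ℕ} (x y : Fin (n + 1) → ℝ) : ℝ :=
  -(x 0 * y 0) + ∑ i : Fin n, x i.succ * y i.succ

/-- The hyperboloid model of the hyperbolic space `ℍⁿ`. -/
def Hyperboloid (n : ℕ) : Set (Fin (n + 1) → ℝ) :=
  {x | mink x x = -1 ∧ 0 < x 0}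

/-- The Klein projection `x ↦ (x₁/x₀, …, xₙ/x₀)` of the hyperboloid onto the unit ball. -/
def kleinMap {n : ℕ} (x : Fin (n + 1) → ℝ) : EuclideanSpace ℝ (Fin n) :=
  WithLp.toLp 2 fun i => x i.succ / x 0

/-- Dimension of a subset of a real vector space: the rank of its vector span. -/
def sdim {n : ℕ} (s : Set (EuclideanSpace ℝ (Fin n))) : ℕ :=
  Module.finrank ℝ (vectorSpan ℝ s)

/-- A convex hyperbolic `n`-polyhedron: a finite intersection of hyperbolic half-spaces
`H_{eᵢ}⁻ = {x : ⟨eᵢ,x⟩ ≤ 0}` (with `⟨eᵢ,eᵢ⟩ = 1`) having nonempty interior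
(equivalently, its Klein-model image has nonempty interior in `ℝⁿ`). -/
structure HypPolyhedron (n : ℕ) where
  m : ℕ
  e : Fin m → (Fin (n + 1) → ℝ)
  unit : ∀ i, mink (e i) (e i) = 1
  nonempty_int :
    (interior (kleinMap '' {x ∈ Hyperboloid n | ∀ i, mink (e i) x ≤ 0})).Nonempty

namespace HypPolyhedron

variable {n : ℕ} (P : HypPolyhedron n)

/-- The set of points of the polyhedron in the hyperboloid model. -/
def carrier : Set (Fin (n + 1) → ℝ) :=
  {x ∈ Hyperboloid n | ∀ i, mink (P.e i) x ≤ 0}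

/-- `P̄`: the closure of the Klein-model image of the polyhedron in the closed unit ball. -/
def cl : Set (EuclideanSpace ℝ (Fin n)) :=
  closure (kleinMap '' P.carrier)

/-- The `k`-faces of `P`: the `k`-dimensional (nonempty) exposed faces of `P̄`. -/
def faces (k : ℕ) : Set (Set (EuclideanSpace ℝ (Fin n))) :=
  {F | IsExposed ℝ P.cl F ∧ F.Nonempty ∧ sdim F = k}

/-- `a_k(P)`: the number of `k`-faces of `P`. -/
def a (k : ℕ) : ℕ := (P.faces k).ncard

/-- Vertices of `P`: the points of `0`-dimensional exposed faces of `P̄`. -/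
def verts : Set (EuclideanSpace ℝ (Fin n)) :=
  {v | IsExposed ℝ P.cl {v}}

/-- Ideal vertices: vertices lying on the unit sphere. -/
def idealVerts : Set (EuclideanSpace ℝ (Fin n)) :=
  {v ∈ P.verts | ‖v‖ = 1}

/-- Finite vertices: vertices lying in the open unit ball. -/
def finiteVerts : Set (EuclideanSpace ℝ (Fin n)) :=
  {v ∈ P.verts | ‖v‖ < 1}

/-- `v_∞(P)`: the number of ideal vertices of `P`. -/
def vInf : ℕ := P.idealVerts.ncard

/-- The bounding hyperplane `H_e` contains the face `F`. -/
def faceInHyperplane (e : Fin (n + 1) → ℝ) (F : Set (EuclideanSpace ℝ (Fin n))) : Prop :=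
  ∀ x ∈ P.carrier, kleinMap x ∈ F → mink e x = 0

/-- `P` is right-angled: whenever two distinct bounding hyperplanes both contain an
`(n-2)`-dimensional face of `P`, the corresponding unit normals are orthogonal,
i.e. the dihedral angle is `π/2`. -/
def IsRightAngled : Prop :=
  ∀ i j : Fin P.m, i ≠ j →
    (∃ F ∈ P.faces (n - 2), P.faceInHyperplane (P.e i) F ∧ P.faceInHyperplane (P.e j) F) →
    mink (P.e i) (P.e j) = 0

/-- `P` has finite volume: `P̄` is the convex hull of its (finitely many) vertices. -/
def FiniteVolume : Prop :=
  P.verts.Finite ∧ P.cl = convexHull ℝ P.verts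

/-- `P` is compact: finite volume and all vertices are finite. -/
def IsCompactPoly : Prop :=
  P.FiniteVolume ∧ ∀ v ∈ P.verts, ‖v‖ < 1

/-- `P` is ideal: finite volume and all vertices are ideal. -/
def IsIdeal : Prop :=
  P.FiniteVolume ∧ ∀ v ∈ P.verts, ‖v‖ = 1

end HypPolyhedron

/-- `ν(P) = a_{n-1}(P) + v_∞(P)` ranging over the family `𝒫ⁿ` of finite-volume non-compact
right-angled convex hyperbolic `n`-polyhedra. -/
def nuSet (n : ℕ) : Set ℕ :=
  {m | ∃ P : HypPolyhedron n,
        P.FiniteVolume ∧ P.IsRightAngled ∧ ¬ P.IsCompactPoly ∧ P.a (n - 1) + P.vInf = m}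

/-- `νₙ = sInf {ν(P) : P ∈ 𝒫ⁿ}` (with `sInf ∅ = 0`). -/
def nu (n : ℕ) : ℕ := sInf (nuSet n)

/-- A right-angled system: a Lorentzian form on a real vector space, with a timelike vector `base`,
and unit spacelike normals which are pairwise orthogonal or ultraparallel, such that the polyhedral
cone they cut out contains `base` in its interior and lies in the closed future light cone. -/
structure RightAngledSystem (ι E : Type) [AddCommGroup E] [Module ℝ E] where
  form : E →ₗ[ℝ] E →ₗ[ℝ] ℝ
  symm : ∀ x y, form x y = form y x
  base : E
  normal : ι → E
  base_neg : form base base < 0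
  pos : ∀ x, form base x = 0 → x ≠ 0 → 0 < form x x
  unit : ∀ i, form (normal i) (normal i) = 1
  angle : ∀ i j, i ≠ j → form (normal i) (normal j) = 0 ∨ form (normal i) (normal j) ≤ -1
  base_mem : ∀ i, form (normal i) base < 0
  causal : ∀ x, (∀ i, form (normal i) x ≤ 0) → form x x ≤ 0
  future : ∀ x, (∀ i, form (normal i) x ≤ 0) → x ≠ 0 → form base x < 0

/-- In a Lorentzian space, a causal vector orthogonal to a nonzero causal vector is a multiple
of it. -/
theorem eq_smul_of_causal_of_orthogonal {E : Type*} [AddCommGroup E] [Module ℝ E]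
    (B : E →ₗ[ℝ] E →ₗ[ℝ] ℝ) (symm : ∀ x y, B x y = B y x) (p : E)
    (pos : ∀ x, B p x = 0 → x ≠ 0 → 0 < B x x) {z x : E} (hz : z ≠ 0) (hzz : B z z ≤ 0)
    (hzx : B z x = 0) (hxx : B x x ≤ 0) : B p z ≠ 0 ∧ x = (B p x / B p z) • z := by
  have hpz : B p z ≠ 0 := fun h => absurd (pos z h hz) (not_lt.mpr hzz)
  refine ⟨hpz, ?_⟩
  have hy : B p x • z - B p z • x = 0 := by
    by_contra hne
    have h1 := pos (B p x • z - B p z • x) (by simp; ring) hne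
    have h2 : B (B p x • z - B p z • x) (B p x • z - B p z • x)
        = (B p x) ^ 2 * B z z + (B p z) ^ 2 * B x x := by
      simp [symm x z, hzx]; ring
    nlinarith [mul_nonneg (sq_nonneg (B p x)) (neg_nonneg.mpr hzz),
      mul_nonneg (sq_nonneg (B p z)) (neg_nonneg.mpr hxx)]
  rw [sub_eq_zero] at hy
  rw [div_eq_inv_mul, mul_smul, hy, smul_smul, inv_mul_cancel₀ hpz, one_smul]

namespace RightAngledSystem

open scoped Classical

variable {ι E : Type} [AddCommGroup E] [Module ℝ E] (P : RightAngledSystem ι E)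

/-- The polyhedral cone cut out by the normals. -/
def cone : Set E := {x | ∀ i, P.form (P.normal i) x ≤ 0}

/-- The ideal points of the cone, normalized against `base`. -/
def ideal : Set E := {z | z ∈ P.cone ∧ P.form z z = 0 ∧ P.form P.base z = -1}

/-- A set of pairwise orthogonal normals; these index the faces. -/
def IsOrtho (S : Finset ι) : Prop :=
  ∀ i ∈ S, ∀ j ∈ S, i ≠ j → P.form (P.normal i) (P.normal j) = 0

/-- The orthogonal projection of `base` onto the span of the face indexed by `S`. -/
def proj (S : Finset ι) : E :=
  P.base - ∑ i ∈ S, P.form (P.normal i) P.base • P.normal i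

variable {P}

theorem IsOrtho.mono {S T : Finset ι} (hT : P.IsOrtho T) (h : S ⊆ T) : P.IsOrtho S :=
  fun i hi j hj => hT i (h hi) j (h hj)

theorem IsOrtho.form_sum {S : Finset ι} (hS : P.IsOrtho S) (c : ι → ℝ) {i : ι} (hi : i ∈ S) :
    P.form (P.normal i) (∑ j ∈ S, c j • P.normal j) = c i := by
  rw [map_sum, Finset.sum_eq_single_of_mem i hi]
  · simp [P.unit]
  · intro j hj hne
    simp [hS i hi j hj hne.symm]

theorem IsOrtho.form_proj {S : Finset ι} (hS : P.IsOrtho S) {i : ι} (hi : i ∈ S) :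
    P.form (P.normal i) (P.proj S) = 0 := by
  rw [proj, map_sub, hS.form_sum (fun i => P.form (P.normal i) P.base) hi, sub_self]

variable (P)

theorem form_normal_nonpos {i j : ι} (h : i ≠ j) : P.form (P.normal i) (P.normal j) ≤ 0 := by
  rcases P.angle i j h with h | h <;> linarith

theorem form_proj_lt {S : Finset ι} {k : ι} (hk : k ∉ S) :
    P.form (P.normal k) (P.proj S) < 0 := by
  rw [proj, map_sub, map_sum]
  have : 0 ≤ ∑ i ∈ S, P.form (P.normal k) (P.form (P.normal i) P.base • P.normal i) := by
    refine Finset.sum_nonneg fun i hi => ?_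
    rw [map_smul, smul_eq_mul]
    exact mul_nonneg_of_nonpos_of_nonpos (P.base_mem i).le
      (P.form_normal_nonpos (by rintro rfl; exact hk hi))
  linarith [P.base_mem k]

theorem form_proj_apply {S : Finset ι} {x : E} (hx : ∀ i ∈ S, P.form (P.normal i) x = 0) :
    P.form (P.proj S) x = P.form P.base x := by
  rw [proj, map_sub, LinearMap.sub_apply, map_sum, LinearMap.sum_apply, Finset.sum_eq_zero, sub_zero]
  intro i hi
  simp [hx i hi]

theorem form_proj_self {S : Finset ι} (hS : P.IsOrtho S) :
    P.form (P.proj S) (P.proj S) < 0 := by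
  rw [P.form_proj_apply fun i hi => hS.form_proj hi, proj, map_sub, map_sum]
  have : 0 ≤ ∑ i ∈ S, P.form P.base (P.form (P.normal i) P.base • P.normal i) := by
    refine Finset.sum_nonneg fun i _ => ?_
    rw [map_smul, smul_eq_mul, P.symm P.base]
    exact mul_self_nonneg _
  linarith [P.base_neg]

theorem proj_mem_cone {S : Finset ι} (hS : P.IsOrtho S) : P.proj S ∈ P.cone := by
  intro i
  by_cases hi : i ∈ S
  · exact (hS.form_proj hi).le
  · exact (P.form_proj_lt hi).le

theorem form_base_proj_neg {S : Finset ι} (hS : P.IsOrtho S) : P.form P.base (P.proj S) < 0 := by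
  rw [← P.form_proj_apply fun i hi => hS.form_proj hi]
  exact P.form_proj_self hS

variable {P}

theorem add_mem_cone {x y : E} (hx : x ∈ P.cone) (hy : y ∈ P.cone) : x + y ∈ P.cone := by
  intro i
  rw [map_add]
  exact add_nonpos (hx i) (hy i)

theorem smul_mem_cone {x : E} (hx : x ∈ P.cone) {t : ℝ} (ht : 0 ≤ t) : t • x ∈ P.cone := by
  intro i
  rw [map_smul, smul_eq_mul]
  exact mul_nonpos_of_nonneg_of_nonpos ht (hx i)

/-- One can move from a point of a polyhedral cone in any direction that does not violate the
active constraints. -/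
theorem exists_add_smul_mem_cone [Finite ι] {v d : E} (hv : v ∈ P.cone)
    (hd : ∀ i, P.form (P.normal i) v = 0 → P.form (P.normal i) d ≤ 0) :
    ∃ ε : ℝ, 0 < ε ∧ v + ε • d ∈ P.cone := by
  have key : ∀ i, ∀ᶠ ε in nhdsWithin (0 : ℝ) (Set.Ioi 0), P.form (P.normal i) (v + ε • d) ≤ 0 := by
    intro i
    rcases (hv i).eq_or_lt with h | h
    · filter_upwards [self_mem_nhdsWithin] with ε hε
      rw [map_add, h, zero_add, map_smul, smul_eq_mul]
      exact mul_nonpos_of_nonneg_of_nonpos (le_of_lt hε) (hd i h)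
    · have hc : Filter.Tendsto (fun ε : ℝ => P.form (P.normal i) v + ε * P.form (P.normal i) d)
          (nhdsWithin 0 (Set.Ioi 0)) (nhds (P.form (P.normal i) v + 0 * P.form (P.normal i) d)) := by
        refine Filter.Tendsto.mono_left ?_ nhdsWithin_le_nhds
        exact Continuous.tendsto (by fun_prop) 0
      rw [zero_mul, add_zero] at hc
      filter_upwards [hc.eventually (gt_mem_nhds h)] with ε hε
      rw [map_add, map_smul, smul_eq_mul]
      exact hε.le
  obtain ⟨ε, h1, h2⟩ := ((Filter.eventually_all.mpr key).and self_mem_nhdsWithin).exists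
  exact ⟨ε, h2, h1⟩

/-- Two distinct non-orthogonal facets meeting at a nonzero point of the cone meet at a
lightlike point. -/
theorem normal_add_normal_of_mem {z : E} (hz : z ∈ P.cone) (hz0 : z ≠ 0) {i j : ι}
    (hi : P.form (P.normal i) z = 0) (hj : P.form (P.normal j) z = 0)
    (hij : P.form (P.normal i) (P.normal j) ≤ -1) :
    P.form z z = 0 ∧ P.form (P.normal i) (P.normal j) = -1 ∧
      ∃ c : ℝ, c ≠ 0 ∧ P.normal i + P.normal j = c • z := by
  have hx : P.form (P.normal i + P.normal j) (P.normal i + P.normal j)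
      = 2 + 2 * P.form (P.normal i) (P.normal j) := by
    simp [P.unit, P.symm (P.normal j) (P.normal i)]; ring
  have hzx : P.form z (P.normal i + P.normal j) = 0 := by
    rw [P.symm]; simp [hi, hj]
  obtain ⟨hpz, hs⟩ := eq_smul_of_causal_of_orthogonal P.form P.symm P.base P.pos hz0
    (P.causal z hz) hzx (by rw [hx]; linarith)
  set c := P.form P.base (P.normal i + P.normal j) / P.form P.base z with hc
  have hc0 : c ≠ 0 := by
    refine div_ne_zero ?_ hpz
    rw [P.symm, map_add, LinearMap.add_apply]
    linarith [P.base_mem i, P.base_mem j]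
  have hzz : P.form z z = 0 := by
    rw [hs, map_smul, smul_eq_mul] at hzx
    exact (mul_eq_zero.mp hzx).resolve_left hc0
  refine ⟨hzz, ?_, c, hc0, hs⟩
  rw [hs] at hx
  simp [hzz] at hx
  linarith

variable {ι E : Type} [AddCommGroup E] [Module ℝ E] {P : RightAngledSystem ι E}

variable (P) in
/-- The linear span of the face indexed by `S`. -/
def perp (S : Finset ι) : Submodule ℝ E where
  carrier := {x | ∀ i ∈ S, P.form (P.normal i) x = 0}
  add_mem' := fun ha hb i hi => by rw [map_add, ha i hi, hb i hi, add_zero]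
  zero_mem' := fun i _ => map_zero _
  smul_mem' := fun c x hx i hi => by rw [map_smul, hx i hi, smul_zero]

theorem mem_perp {S : Finset ι} {x : E} :
    x ∈ P.perp S ↔ ∀ i ∈ S, P.form (P.normal i) x = 0 := Iff.rfl

theorem finrank_perp [FiniteDimensional ℝ E] {S : Finset ι} (hS : P.IsOrtho S) :
    Module.finrank ℝ (P.perp S) + S.card = Module.finrank ℝ E := by
  let φ : E →ₗ[ℝ] (S → ℝ) := LinearMap.pi fun i => P.form (P.normal i)
  have hker : LinearMap.ker φ = P.perp S := by
    ext x
    simp [φ, mem_perp, funext_iff]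
  have hsurj : LinearMap.range φ = ⊤ := by
    rw [LinearMap.range_eq_top]
    intro c
    refine ⟨∑ j ∈ S, (if h : j ∈ S then c ⟨j, h⟩ else 0) • P.normal j, ?_⟩
    ext ⟨i, hi⟩
    simp only [φ, LinearMap.pi_apply]
    rw [hS.form_sum (fun j => if h : j ∈ S then c ⟨j, h⟩ else 0) hi]
    simp [hi]
  have := LinearMap.finrank_range_add_finrank_ker φ
  rw [hker, hsurj, finrank_top] at this
  simp at this
  omega

theorem exists_mem_perp [FiniteDimensional ℝ E] {S : Finset ι}
    (hS : S.card + 3 ≤ Module.finrank ℝ E) (u w : E) :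
    ∃ d ∈ P.perp S, d ≠ 0 ∧ P.form u d = 0 ∧ P.form w d = 0 := by
  let φ : E →ₗ[ℝ] ((S → ℝ) × ℝ × ℝ) :=
    (LinearMap.pi fun i : S => P.form (P.normal i)).prod ((P.form u).prod (P.form w))
  have hlt : Module.finrank ℝ ((S → ℝ) × ℝ × ℝ) < Module.finrank ℝ E := by
    simp; omega
  obtain ⟨d, hd, hd0⟩ := (Submodule.ne_bot_iff _).mp (LinearMap.ker_ne_bot_of_finrank_lt hlt (f := φ))
  simp [φ, funext_iff] at hd
  exact ⟨d, fun i hi => hd.1 i hi, hd0, hd.2.1, hd.2.2⟩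

/-- If a ray from the centre of a face stays inside the adjacent facets, then it cannot leave the
cone at a nonzero point. -/
theorem false_of_exit [Finite ι] [FiniteDimensional ℝ E] {S : Finset ι}
    (hdim : S.card + 3 ≤ Module.finrank ℝ E) {z : E} (hz : z ∈ P.cone) (hz0 : z ≠ 0)
    (hzS : z ∈ P.perp S)
    (hlink : ∀ j, (∀ i ∈ S, P.form (P.normal i) (P.normal j) = 0) → P.form (P.normal j) z < 0)
    {k : ι} (hkS : k ∉ S) (hk : P.form (P.normal k) z = 0) : False := by
  have partner : ∀ l, l ∉ S → P.form (P.normal l) z = 0 →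
      ∃ i ∈ S, P.form z z = 0 ∧ ∃ c : ℝ, P.normal i + P.normal l = c • z := by
    intro l hl hlz
    by_contra hcon
    refine absurd (hlink l fun i hi => ?_) (by rw [hlz]; exact lt_irrefl 0)
    rcases P.angle i l (by rintro rfl; exact hl hi) with h | h
    · exact h
    · obtain ⟨h1, -, c, -, h2⟩ := normal_add_normal_of_mem hz hz0 (hzS i hi) hlz h
      exact absurd ⟨i, hi, h1, c, h2⟩ hcon
  obtain ⟨d, hdS, hd0, hdz, hdp⟩ := P.exists_mem_perp hdim z P.base
  obtain ⟨-, -, hzz, -⟩ := partner k hkS hk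
  obtain ⟨ε, hε, hmem⟩ := exists_add_smul_mem_cone (d := d) hz (by
    intro l hl
    by_cases hlS : l ∈ S
    · exact (hdS l hlS).le
    · obtain ⟨i, hi, -, c, hc⟩ := partner l hlS hl
      have : P.form (P.normal i + P.normal l) d = 0 := by rw [hc]; simp [hdz]
      rw [map_add, LinearMap.add_apply, hdS i hi, zero_add] at this
      exact this.le)
  have h1 := P.causal _ hmem
  have h2 : P.form (z + ε • d) (z + ε • d) = ε ^ 2 * P.form d d := by
    simp [hzz, hdz, P.symm d z]; ring
  rw [h2] at h1
  exact absurd h1 (not_le.mpr (mul_pos (pow_pos hε 2) (P.pos d hdp hd0)))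

/-- A face is cut out of its span by the adjacent facets only. -/
theorem mem_cone_of_mem_perp [Fintype ι] [FiniteDimensional ℝ E] {S : Finset ι}
    (hS : P.IsOrtho S) (hdim : S.card + 3 ≤ Module.finrank ℝ E) {x : E} (hxS : x ∈ P.perp S)
    (hx : ∀ j, (∀ i ∈ S, P.form (P.normal i) (P.normal j) = 0) → P.form (P.normal j) x ≤ 0) :
    x ∈ P.cone := by
  have main : ∀ y ∈ P.perp S,
      (∀ j, (∀ i ∈ S, P.form (P.normal i) (P.normal j) = 0) → P.form (P.normal j) y ≤ 0) →
      y ∉ P.cone → ∃ s : ℝ, 0 < s ∧ P.proj S + s • y = 0 := by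
    intro y hyS hy hyK
    set viol := Finset.univ.filter fun k => 0 < P.form (P.normal k) y with hviol
    have hne : viol.Nonempty := by
      by_contra hcon
      refine hyK fun i => ?_
      by_contra hi
      exact hcon ⟨i, by simpa [hviol] using hi⟩
    obtain ⟨k, hkv, hmin⟩ := viol.exists_min_image
      (fun k => -P.form (P.normal k) (P.proj S) / P.form (P.normal k) y) hne
    have hky : 0 < P.form (P.normal k) y := by simpa [hviol] using hkv
    have hkS : k ∉ S := fun h => hky.ne' (hyS k h)
    have hs : 0 < -P.form (P.normal k) (P.proj S) / P.form (P.normal k) y :=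
      div_pos (neg_pos.mpr (P.form_proj_lt hkS)) hky
    set s := -P.form (P.normal k) (P.proj S) / P.form (P.normal k) y with hsdef
    refine ⟨s, hs, ?_⟩
    by_contra hz0
    refine false_of_exit (P := P) hdim (z := P.proj S + s • y) ?_ hz0 ?_ ?_ hkS ?_
    · intro l
      rw [map_add, map_smul, smul_eq_mul]
      rcases le_or_gt (P.form (P.normal l) y) 0 with h | h
      · have := P.proj_mem_cone hS l
        nlinarith
      · have := hmin l (by simpa [hviol] using h)
        rw [le_div_iff₀ h] at this
        linarith
    · exact (P.perp S).add_mem (fun i hi => hS.form_proj hi) ((P.perp S).smul_mem _ hyS)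
    · intro j hj
      have hjS : j ∉ S := fun h => by simpa [P.unit] using hj j h
      rw [map_add, map_smul, smul_eq_mul]
      have := P.form_proj_lt hjS
      nlinarith [hy j hj]
    · rw [map_add, map_smul, smul_eq_mul, hsdef]
      field_simp
      ring
  by_contra hxK
  obtain ⟨s, hs, hsx⟩ := main x hxS hx hxK
  have hempty : ∀ j, ¬ ∀ i ∈ S, P.form (P.normal i) (P.normal j) = 0 := by
    intro j hj
    have hjS : j ∉ S := fun h => by simpa [P.unit] using hj j h
    have h1 : P.form (P.normal j) (P.proj S + s • x) = 0 := by rw [hsx, map_zero]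
    rw [map_add, map_smul, smul_eq_mul] at h1
    have := P.form_proj_lt hjS
    nlinarith [hx j hj]
  obtain ⟨d, hdS, hd0, hd1, hd2⟩ := P.exists_mem_perp hdim (P.proj S) P.base
  obtain ⟨t, -, ht⟩ := main d hdS (fun j hj => absurd hj (hempty j))
    (fun h => absurd (P.causal d h) (not_le.mpr (P.pos d hd2 hd0)))
  have h1 : P.form (P.proj S) (P.proj S + t • d) = 0 := by rw [ht, map_zero]
  rw [map_add, map_smul, hd1, smul_zero, add_zero] at h1
  exact (P.form_proj_self hS).ne h1

variable (P) in
/-- The indices of the facets of the face indexed by `S`. -/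
def Link (S : Finset ι) : Type := {j // ∀ i ∈ S, P.form (P.normal i) (P.normal j) = 0}

noncomputable instance [Fintype ι] (S : Finset ι) : Fintype (P.Link S) :=
  inferInstanceAs (Fintype {j // ∀ i ∈ S, P.form (P.normal i) (P.normal j) = 0})

/-- The right-angled system of a face of dimension at least two. -/
noncomputable def face [Fintype ι] [FiniteDimensional ℝ E] {S : Finset ι} (hS : P.IsOrtho S)
    (hdim : S.card + 3 ≤ Module.finrank ℝ E) : RightAngledSystem (P.Link S) (P.perp S) where
  form := P.form.domRestrict₁₂ (P.perp S) (P.perp S)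
  symm x y := P.symm x y
  base := ⟨P.proj S, fun _ hi => hS.form_proj hi⟩
  normal j := ⟨P.normal j.1, j.2⟩
  base_neg := P.form_proj_self hS
  pos x hx hx0 := by
    refine P.pos x ?_ fun h => hx0 (Subtype.ext h)
    rw [← P.form_proj_apply (S := S) x.2]
    exact hx
  unit j := P.unit j.1
  angle i j hij := P.angle i.1 j.1 fun h => hij (Subtype.ext h)
  base_mem j := P.form_proj_lt fun h => by simpa [P.unit] using j.2 j.1 h
  causal x hx := P.causal x (mem_cone_of_mem_perp hS hdim x.2 fun j hj => hx ⟨j, hj⟩)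
  future x hx hx0 := by
    have := P.future x (mem_cone_of_mem_perp hS hdim x.2 fun j hj => hx ⟨j, hj⟩)
      fun h => hx0 (Subtype.ext h)
    rw [← P.form_proj_apply (S := S) x.2] at this
    exact this

theorem mem_ideal_face [Fintype ι] [FiniteDimensional ℝ E] {S : Finset ι} (hS : P.IsOrtho S)
    (hdim : S.card + 3 ≤ Module.finrank ℝ E) (z : P.perp S) :
    z ∈ (P.face hS hdim).ideal ↔ (z : E) ∈ P.ideal := by
  have hb : (P.face hS hdim).form (P.face hS hdim).base z = P.form P.base z :=
    P.form_proj_apply (S := S) z.2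
  refine and_congr ⟨fun h => ?_, fun h j => h j.1⟩ (and_congr Iff.rfl (by rw [hb]))
  exact mem_cone_of_mem_perp hS hdim z.2 fun j hj => h ⟨j, hj⟩

set_option linter.unusedSectionVars false

section Vertices

variable {ι E : Type} [Fintype ι] [NormedAddCommGroup E] [NormedSpace ℝ E]
  [FiniteDimensional ℝ E] {P : RightAngledSystem ι E}

variable (P) in
/-- The affine slice of the cone on which `form base` is `-1`. -/
def slice : Set E := {x | x ∈ P.cone ∧ P.form P.base x = -1}

variable (P) in
/-- The indices of the facets containing a point. -/
noncomputable def active (x : E) : Finset ι := Finset.univ.filter fun i => P.form (P.normal i) x = 0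

variable (P) in
/-- The vertices, finite or ideal, normalized against `base`. -/
def vertices : Set E := P.slice.extremePoints ℝ


theorem mem_active {x : E} {i : ι} : i ∈ P.active x ↔ P.form (P.normal i) x = 0 := by
  simp [active]

theorem isClosed_cone : IsClosed P.cone := by
  have : P.cone = ⋂ i, {x | P.form (P.normal i) x ≤ 0} := by ext; simp [cone]
  rw [this]
  exact isClosed_iInter fun i => isClosed_le
    (LinearMap.continuous_of_finiteDimensional _) continuous_const

theorem isCompact_slice : IsCompact P.slice := by
  have hcont : Continuous (P.form P.base) := LinearMap.continuous_of_finiteDimensional _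
  refine Metric.isCompact_of_isClosed_isBounded
    (isClosed_cone.inter (isClosed_eq hcont continuous_const)) ?_
  have hK : IsCompact (Metric.sphere (0 : E) 1 ∩ P.cone) :=
    (isCompact_sphere 0 1).inter_right isClosed_cone
  have hnorm : ∀ x ∈ P.slice, x ≠ 0 := by
    rintro x hx rfl
    simpa using hx.2
  have hmem : ∀ x ∈ P.slice, ‖x‖⁻¹ • x ∈ Metric.sphere (0 : E) 1 ∩ P.cone := by
    intro x hx
    refine ⟨?_, smul_mem_cone hx.1 (inv_nonneg.mpr (norm_nonneg x))⟩
    simp [norm_smul, hnorm x hx]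
  rcases (Metric.sphere (0 : E) 1 ∩ P.cone).eq_empty_or_nonempty with h | h
  · rw [Metric.isBounded_iff_subset_closedBall 0]
    exact ⟨0, fun x hx => absurd (hmem x hx) (by simp [h])⟩
  · obtain ⟨y, hy, hmax⟩ := hK.exists_isMaxOn h hcont.continuousOn
    have hy0 : y ≠ 0 := by
      rintro rfl
      simpa using hy.1
    have hneg := P.future y hy.2 hy0
    rw [Metric.isBounded_iff_subset_closedBall 0]
    refine ⟨(-P.form P.base y)⁻¹, fun x hx => ?_⟩
    have h1 : P.form P.base (‖x‖⁻¹ • x) ≤ P.form P.base y := hmax (hmem x hx)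
    have hx0 : 0 < ‖x‖ := norm_pos_iff.mpr (hnorm x hx)
    rw [map_smul, hx.2, smul_eq_mul, mul_neg_one] at h1
    rw [mem_closedBall_zero_iff]
    rw [le_inv_comm₀ hx0 (by linarith)]
    linarith

theorem ne_zero_of_mem_slice {x : E} (hx : x ∈ P.slice) : x ≠ 0 := by
  rintro rfl
  simpa using hx.2

theorem normalize_mem_slice {x : E} (hx : x ∈ P.cone) (h : P.form P.base x < 0) :
    (-P.form P.base x)⁻¹ • x ∈ P.slice := by
  refine ⟨smul_mem_cone hx (inv_nonneg.mpr (by linarith)), ?_⟩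
  rw [map_smul, smul_eq_mul, inv_neg, neg_mul, inv_mul_cancel₀ h.ne]

/-- At a vertex the active constraints determine the point up to scaling. -/
theorem eq_smul_of_mem_perp_active {v d : E} (hv : v ∈ P.vertices) (hd : d ∈ P.perp (P.active v)) :
    d = (-P.form P.base d) • v := by
  obtain ⟨hvs, hext⟩ := mem_extremePoints.mp hv
  set e := d + P.form P.base d • v with he
  have hb : P.form P.base e = 0 := by simp [he, hvs.2]
  have ha : ∀ i, P.form (P.normal i) v = 0 → P.form (P.normal i) e = 0 := by
    intro i hi
    simp [he, hi, hd i (mem_active.mpr hi)]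
  obtain ⟨s, hs, hs'⟩ := exists_add_smul_mem_cone (d := e) hvs.1 fun i hi => (ha i hi).le
  obtain ⟨t, ht, ht'⟩ := exists_add_smul_mem_cone (d := -e) hvs.1 fun i hi => by simp [ha i hi]
  have h := (hext (v + s • e) ⟨hs', by simp [hb, hvs.2]⟩ (v + t • -e) ⟨ht', by simp [hb, hvs.2]⟩
    ⟨t / (s + t), s / (s + t), by positivity, by positivity, by field_simp; ring, by
      match_scalars <;> field_simp <;> ring⟩).1
  have : e = 0 := by
    have h' : s • e = 0 := by simpa using h
    exact (smul_eq_zero.mp h').resolve_left hs.ne'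
  rw [neg_smul]
  exact eq_neg_of_add_eq_zero_left (he ▸ this)

theorem eq_of_active_subset {v w : E} (hv : v ∈ P.vertices) (hw : w ∈ P.slice)
    (h : P.active v ⊆ P.active w) : w = v := by
  have := eq_smul_of_mem_perp_active (d := w) hv fun i hi => mem_active.mp (h hi)
  rw [this, hw.2]
  simp

variable (P) in
theorem vertices_finite : P.vertices.Finite := by
  refine Set.Finite.of_injOn (f := P.active) (Set.mapsTo_univ _ _) ?_ Set.finite_univ
  intro v hv w hw h
  exact (eq_of_active_subset hv hw.1 h.subset).symm

theorem mem_slice_of_mem_ideal {z : E} (hz : z ∈ P.ideal) : z ∈ P.slice := ⟨hz.1, hz.2.2⟩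

theorem form_nonpos_of_mem_cone {z x : E} (hz : z ∈ P.cone) (hzz : P.form z z = 0)
    (hx : x ∈ P.cone) : P.form z x ≤ 0 := by
  by_contra! h
  have h1 := P.causal _ (add_mem_cone (smul_mem_cone hz
    (t := (1 - P.form x x) / P.form z x) (div_nonneg (by linarith [P.causal x hx]) h.le)) hx)
  have h2 : (1 - P.form x x) / P.form z x * P.form z x = 1 - P.form x x := by field_simp
  have h3 : P.form (((1 - P.form x x) / P.form z x) • z + x)
      (((1 - P.form x x) / P.form z x) • z + x) =
      2 * ((1 - P.form x x) / P.form z x * P.form z x) + P.form x x := by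
    simp [hzz, P.symm x z]; ring
  rw [h3, h2] at h1
  linarith [P.causal x hx]

theorem eq_of_form_eq_zero {z x : E} (hz : z ∈ P.ideal) (hx : x ∈ P.slice)
    (h : P.form z x = 0) : x = z := by
  have := (eq_smul_of_causal_of_orthogonal P.form P.symm P.base P.pos
    (ne_zero_of_mem_slice (mem_slice_of_mem_ideal hz)) hz.2.1.le h (P.causal x hx.1)).2
  rw [this, hx.2, hz.2.2]
  simp

theorem mem_vertices_of_mem_ideal {z : E} (hz : z ∈ P.ideal) : z ∈ P.vertices := by
  refine mem_extremePoints.mpr ⟨mem_slice_of_mem_ideal hz, ?_⟩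
  rintro x hx y hy ⟨a, b, ha, hb, hab, h⟩
  have hzx := form_nonpos_of_mem_cone hz.1 hz.2.1 hx.1
  have hzy := form_nonpos_of_mem_cone hz.1 hz.2.1 hy.1
  have hsum : a * P.form z x + b * P.form z y = 0 := by
    have := congrArg (P.form z) h
    simpa [hz.2.1] using this
  constructor
  · exact eq_of_form_eq_zero hz hx (by nlinarith)
  · exact eq_of_form_eq_zero hz hy (by nlinarith)

variable (P) in
theorem ideal_finite : P.ideal.Finite :=
  P.vertices_finite.subset fun _ => mem_vertices_of_mem_ideal

/-- Every linear functional attains its minimum over a face at a vertex of the face. -/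
theorem exists_vertex_min {S : Finset ι} (hS : P.IsOrtho S) (f : E →ₗ[ℝ] ℝ) :
    ∃ v ∈ P.vertices, v ∈ P.perp S ∧ ∀ x ∈ P.slice, x ∈ P.perp S → f v ≤ f x := by
  have hf : Continuous f := LinearMap.continuous_of_finiteDimensional _
  have hK : IsCompact (P.slice ∩ P.perp S) :=
    isCompact_slice.inter_right (P.perp S).closed_of_finiteDimensional
  obtain ⟨y, hy, hmin⟩ := hK.exists_isMinOn ⟨_, normalize_mem_slice (P.proj_mem_cone hS)
    (P.form_base_proj_neg hS), (P.perp S).smul_mem _ fun i hi => hS.form_proj hi⟩ hf.continuousOn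
  have hmin' : ∀ x ∈ P.slice, x ∈ P.perp S → f y ≤ f x := fun x h1 h2 => hmin ⟨h1, h2⟩
  set M : Set E := (P.slice ∩ P.perp S) ∩ {x | f x = f y} with hM
  have hMc : IsCompact M := hK.inter_right (isClosed_eq hf continuous_const)
  obtain ⟨v, hv⟩ := hMc.extremePoints_nonempty ⟨y, hy, rfl⟩
  have hext : IsExtreme ℝ P.slice M := by
    refine ⟨fun x hx => hx.1.1, ?_⟩
    rintro x hx w hw z hz ⟨a, b, ha, hb, hab, rfl⟩
    have hperp : ∀ i ∈ S, P.form (P.normal i) x = 0 ∧ P.form (P.normal i) w = 0 := by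
      intro i hi
      have h := hz.1.2 i hi
      simp only [map_add, map_smul, smul_eq_mul] at h
      have h1 := hx.1 i
      have h2 := hw.1 i
      constructor <;> nlinarith
    refine ⟨⟨hx, fun i hi => (hperp i hi).1⟩, ?_⟩
    have h : f (a • x + b • w) = f y := hz.2
    have h1 := hmin' x hx fun i hi => (hperp i hi).1
    have h2 := hmin' w hw fun i hi => (hperp i hi).2
    simp only [map_add, map_smul, smul_eq_mul] at h
    show f x = f y
    obtain rfl : b = 1 - a := by linarith
    nlinarith
  refine ⟨v, hext.extremePoints_subset_extremePoints hv, hv.1.1.2, fun x h1 h2 => ?_⟩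
  rw [show f v = f y from hv.1.2]
  exact hmin' x h1 h2

end Vertices

section Local

variable {ι E : Type} [Fintype ι] [NormedAddCommGroup E] [NormedSpace ℝ E]
  [FiniteDimensional ℝ E] {P : RightAngledSystem ι E}

variable (P) in
/-- The vertex `v` minimizes `f` over the face indexed by `S`. -/
def IsLowest (f : E →ₗ[ℝ] ℝ) (v : E) (S : Finset ι) : Prop :=
  S ⊆ P.active v ∧ ∀ x ∈ P.slice, x ∈ P.perp S → f v ≤ f x

variable (P) in
/-- The linear functional agreeing with `f - f v` on the affine hyperplane of the slice. -/
noncomputable def tilt (f : E →ₗ[ℝ] ℝ) (v : E) : E →ₗ[ℝ] ℝ := f + f v • P.form P.base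

theorem tilt_apply (f : E →ₗ[ℝ] ℝ) (v x : E) :
    P.tilt f v x = f x + f v * P.form P.base x := rfl

theorem tilt_self {v : E} (f : E →ₗ[ℝ] ℝ) (hv : v ∈ P.slice) : P.tilt f v v = 0 := by
  rw [tilt_apply, hv.2]; ring

theorem tilt_neg (f : E →ₗ[ℝ] ℝ) (v x : E) : P.tilt (-f) v x = -P.tilt f v x := by
  simp only [tilt_apply, LinearMap.neg_apply]; ring

theorem isLowest_iff {f : E →ₗ[ℝ] ℝ} {v : E} {S : Finset ι} :
    P.IsLowest f v S ↔
      S ⊆ P.active v ∧ ∀ x ∈ P.cone, x ∈ P.perp S → 0 ≤ P.tilt f v x := by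
  refine and_congr Iff.rfl ⟨fun h x hx hxS => ?_, fun h x hx hxS => ?_⟩
  · rcases eq_or_ne x 0 with rfl | hx0
    · simp
    · have hneg := P.future x hx hx0
      have h1 := h _ (normalize_mem_slice hx hneg) ((P.perp S).smul_mem _ hxS)
      rw [map_smul, smul_eq_mul, inv_mul_eq_div, le_div_iff₀ (by linarith)] at h1
      rw [tilt_apply]
      linarith
  · have := h x hx.1 hxS
    rw [tilt_apply, hx.2] at this
    linarith

theorem mem_perp_active (v : E) : v ∈ P.perp (P.active v) := fun _ hi => mem_active.mp hi

theorem isOrtho_active {v : E} (hv : v ∈ P.slice) (hneg : P.form v v < 0) :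
    P.IsOrtho (P.active v) := by
  intro i hi j hj hij
  refine (P.angle i j hij).resolve_right fun h => ?_
  exact hneg.ne (normal_add_normal_of_mem hv.1 (ne_zero_of_mem_slice hv) (mem_active.mp hi)
    (mem_active.mp hj) h).1

theorem card_active {v : E} (hv : v ∈ P.vertices) (hneg : P.form v v < 0) :
    (P.active v).card + 1 = Module.finrank ℝ E := by
  rw [← finrank_perp (isOrtho_active hv.1 hneg), add_comm, add_left_inj]
  symm
  refine finrank_eq_one (⟨v, mem_perp_active v⟩ : P.perp (P.active v)) ?_ fun w => ?_
  · exact fun h => ne_zero_of_mem_slice hv.1 (congrArg Subtype.val h)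
  · exact ⟨-P.form P.base w, Subtype.ext (eq_smul_of_mem_perp_active hv w.2).symm⟩

/-- At a finite vertex, `f` is minimal on a face exactly if it increases along all edges of the
face. -/
theorem isLowest_iff_of_neg {f : E →ₗ[ℝ] ℝ} {v : E} (hv : v ∈ P.vertices) (hneg : P.form v v < 0)
    (hf : ∀ i ∈ P.active v, P.tilt f v (P.normal i) ≠ 0) {S : Finset ι} :
    P.IsLowest f v S ↔
      S ⊆ P.active v ∧ ∀ i ∈ P.active v, i ∉ S → P.tilt f v (P.normal i) < 0 := by
  have hA := isOrtho_active hv.1 hneg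
  rw [isLowest_iff]
  refine and_congr_right fun hSA => ⟨fun h i hi hiS => ?_, fun h x hx hxS => ?_⟩
  · have hd : ∀ j, P.form (P.normal j) v = 0 → P.form (P.normal j) (-P.normal i) ≤ 0 := by
      intro j hj
      rcases eq_or_ne j i with rfl | hji
      · simp [P.unit]
      · simp [hA j (mem_active.mpr hj) i hi hji]
    obtain ⟨ε, hε, hmem⟩ := exists_add_smul_mem_cone hv.1.1 hd
    have hperp : v + ε • -P.normal i ∈ P.perp S := by
      intro j hj
      have hji : j ≠ i := by rintro rfl; exact hiS hj
      simp [mem_active.mp (hSA hj), hA j (hSA hj) i hi hji]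
    have h1 := h _ hmem hperp
    rw [map_add, tilt_self f hv.1, map_smul, map_neg, smul_eq_mul] at h1
    exact lt_of_le_of_ne (by nlinarith) (hf i hi)
  · have hy : x - ∑ i ∈ P.active v, P.form (P.normal i) x • P.normal i
        ∈ P.perp (P.active v) := by
      intro i hi
      rw [map_sub, hA.form_sum (fun i => P.form (P.normal i) x) hi, sub_self]
    have h1 := congrArg (P.tilt f v) (eq_smul_of_mem_perp_active hv hy)
    rw [map_smul _ _ v, tilt_self f hv.1, smul_zero, map_sub, sub_eq_zero] at h1
    rw [h1, map_sum]
    refine Finset.sum_nonneg fun i hi => ?_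
    rw [map_smul, smul_eq_mul]
    by_cases hiS : i ∈ S
    · simp [hxS i hiS]
    · exact mul_nonneg_of_nonpos_of_nonpos (hx i) (h i hi hiS).le

variable (P) in
/-- The structure of an ideal vertex: its facets come in opposite pairs, one member of each pair
being selected in `side`. -/
structure Frame (v : E) where
  side : Finset ι
  opp : ι → ι
  scale : ι → ℝ
  mem_ideal : v ∈ P.ideal
  ortho : P.IsOrtho side
  mem : ∀ i ∈ side, P.form (P.normal i) v = 0
  scale_pos : ∀ i ∈ side, 0 < scale i
  add_opp : ∀ i ∈ side, P.normal i + P.normal (opp i) = scale i • v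
  cover : ∀ j, P.form (P.normal j) v = 0 → j ∈ side ∨ ∃ i ∈ side, opp i = j

theorem exists_opp {v : E} (hv : v ∈ P.ideal) {i : ι} (hi : P.form (P.normal i) v = 0) :
    ∃ j, P.form (P.normal j) v = 0 ∧
      ∃ c : ℝ, 0 < c ∧ P.normal i + P.normal j = c • v := by
  have hvs := mem_slice_of_mem_ideal hv
  by_cases h : ∃ j, P.form (P.normal j) v = 0 ∧ P.form (P.normal i) (P.normal j) ≤ -1
  · obtain ⟨j, hj, hij⟩ := h
    obtain ⟨-, -, c, -, hc⟩ := normal_add_normal_of_mem hv.1 (ne_zero_of_mem_slice hvs) hi hj hij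
    refine ⟨j, hj, c, ?_, hc⟩
    have h1 := congrArg (P.form P.base) hc
    rw [map_add, map_smul, hv.2.2, P.symm, P.symm _ (P.normal j), smul_eq_mul] at h1
    linarith [P.base_mem i, P.base_mem j]
  · exfalso
    push Not at h
    have hd : ∀ j, P.form (P.normal j) v = 0 → P.form (P.normal j) (-P.normal i) ≤ 0 := by
      intro j hj
      rcases eq_or_ne i j with rfl | hij
      · simp [P.unit]
      · rcases P.angle i j hij with h0 | h0
        · simp [P.symm (P.normal j), h0]
        · exact absurd h0 (not_le.mpr (h j hj))
    obtain ⟨ε, hε, hmem⟩ := exists_add_smul_mem_cone hv.1 hd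
    have h1 := P.causal _ hmem
    have h2 : P.form (v + ε • -P.normal i) (v + ε • -P.normal i) = ε ^ 2 := by
      simp [hv.2.1, hi, P.symm v, P.unit]; ring
    rw [h2] at h1
    exact absurd h1 (not_le.mpr (pow_pos hε 2))

/-- Opposite facets at an ideal vertex are unique. -/
theorem opp_unique {v : E} {i j k : ι} (hj : P.form (P.normal j) v = 0) {c d : ℝ}
    (hc : P.normal i + P.normal j = c • v) (hd : P.normal i + P.normal k = d • v) : j = k := by
  by_contra hjk
  have h1 : P.normal j - P.normal k = (c - d) • v := by
    rw [sub_smul, ← hc, ← hd]; abel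
  have h2 := congrArg (P.form (P.normal j)) h1
  rw [map_sub, map_smul, hj, P.unit, smul_zero] at h2
  linarith [P.form_normal_nonpos hjk]

theorem exists_frame {v : E} (hv : v ∈ P.ideal) {g : E →ₗ[ℝ] ℝ} (hgv : g v = 0)
    (hg : ∀ i, P.form (P.normal i) v = 0 → g (P.normal i) ≠ 0) :
    ∃ F : P.Frame v, ∀ i ∈ F.side, g (P.normal i) < 0 := by
  choose! o ho c hc hsum using fun i => exists_opp (P := P) hv (i := i)
  have hgo : ∀ i, P.form (P.normal i) v = 0 → g (P.normal i) + g (P.normal (o i)) = 0 := by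
    intro i hi
    rw [← map_add, hsum i hi, map_smul, hgv, smul_zero]
  refine ⟨⟨(P.active v).filter fun i => g (P.normal i) < 0, o, c, hv, ?_, ?_, ?_, ?_, ?_⟩, ?_⟩
  · intro i hi j hj hij
    simp only [Finset.mem_filter, mem_active] at hi hj
    refine (P.angle i j hij).resolve_right fun h => ?_
    obtain ⟨-, -, d, -, hd⟩ := normal_add_normal_of_mem hv.1
      (ne_zero_of_mem_slice (mem_slice_of_mem_ideal hv)) hi.1 hj.1 h
    obtain rfl := opp_unique (ho i hi.1) (hsum i hi.1) hd
    linarith [hgo i hi.1]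
  · intro i hi
    exact mem_active.mp (Finset.mem_filter.mp hi).1
  · intro i hi
    exact hc i (mem_active.mp (Finset.mem_filter.mp hi).1)
  · intro i hi
    exact hsum i (mem_active.mp (Finset.mem_filter.mp hi).1)
  · intro j hj
    by_cases h : g (P.normal j) < 0
    · exact Or.inl (Finset.mem_filter.mpr ⟨mem_active.mpr hj, h⟩)
    · refine Or.inr ⟨o j, Finset.mem_filter.mpr ⟨mem_active.mpr (ho j hj), ?_⟩, ?_⟩
      · have := lt_of_le_of_ne (not_lt.mp h) (hg j hj).symm
        linarith [hgo j hj]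
      · refine opp_unique (ho _ (ho j hj)) (hsum _ (ho j hj)) (c := c (o j)) (d := c j) ?_
        rw [add_comm]
        exact hsum j hj
  · intro i hi
    exact (Finset.mem_filter.mp hi).2

namespace Frame

variable {v : E} (F : P.Frame v)

theorem form_opp (i : ι) (hi : i ∈ F.side) (x : E) :
    P.form (P.normal (F.opp i)) x = F.scale i * P.form v x - P.form (P.normal i) x := by
  have := congrArg (fun y => P.form y x) (F.add_opp i hi)
  simp only [map_add, LinearMap.add_apply, map_smul, LinearMap.smul_apply, smul_eq_mul] at this
  linarith

theorem form_opp_base {i : ι} (hi : i ∈ F.side) : P.form (P.normal (F.opp i)) v = 0 := by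
  rw [F.form_opp i hi, F.mem i hi, F.mem_ideal.2.1]; ring

theorem form_opp_self {i : ι} (hi : i ∈ F.side) :
    P.form (P.normal i) (P.normal (F.opp i)) = -1 := by
  rw [P.symm, F.form_opp i hi, P.unit, P.symm, F.mem i hi]; ring

theorem form_opp_of_ne {i j : ι} (hi : i ∈ F.side) (hj : j ∈ F.side) (h : i ≠ j) :
    P.form (P.normal i) (P.normal (F.opp j)) = 0 := by
  rw [P.symm, F.form_opp j hj, P.symm v, F.mem i hi, F.ortho j hj i hi h.symm]; ring

theorem form_opp_opp {i j : ι} (hi : i ∈ F.side) (hj : j ∈ F.side) (h : i ≠ j) :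
    P.form (P.normal (F.opp i)) (P.normal (F.opp j)) = 0 := by
  rw [F.form_opp i hi, P.symm v, F.form_opp_base hj, F.form_opp_of_ne hi hj h]; ring

theorem opp_injOn : Set.InjOn F.opp F.side := by
  intro i hi j hj h
  by_contra hij
  have h1 := F.form_opp_of_ne hi hj hij
  rw [← h, F.form_opp_self hi] at h1
  norm_num at h1

theorem opp_notMem {i : ι} (hi : i ∈ F.side) : F.opp i ∉ F.side := by
  intro h
  by_cases hij : F.opp i = i
  · have := F.form_opp_self hi
    rw [hij, P.unit] at this
    norm_num at this
  · have := F.form_opp_self hi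
    rw [F.ortho i hi _ h (Ne.symm hij)] at this
    norm_num at this

theorem eq_smul {x : E} (h : ∀ i ∈ F.side, P.form (P.normal i) x = 0) (hx : P.form v x = 0) :
    x = (-P.form P.base x) • v := by
  refine eq_smul_of_mem_perp_active (mem_vertices_of_mem_ideal F.mem_ideal) fun j hj => ?_
  rcases F.cover j (mem_active.mp hj) with hj | ⟨i, hi, rfl⟩
  · exact h j hj
  · rw [F.form_opp i hi, hx, h i hi]; ring

theorem form_proj : P.form v (P.proj F.side) = -1 := by
  rw [P.symm, P.form_proj_apply fun i hi => F.mem i hi, F.mem_ideal.2.2]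

theorem card_side : F.side.card + 2 = Module.finrank ℝ E := by
  rw [← finrank_perp F.ortho, add_comm, add_left_inj]
  let φ : P.perp F.side →ₗ[ℝ] ℝ := (P.form v).domRestrict _
  have hker : Module.finrank ℝ (LinearMap.ker φ) = 1 := by
    refine finrank_eq_one (⟨⟨v, fun i hi => F.mem i hi⟩, F.mem_ideal.2.1⟩ : LinearMap.ker φ) ?_
      fun w => ?_
    · intro h
      exact ne_zero_of_mem_slice (mem_slice_of_mem_ideal F.mem_ideal)
        (congrArg Subtype.val (congrArg Subtype.val h))
    · exact ⟨-P.form P.base w, Subtype.ext (Subtype.ext (F.eq_smul w.1.2 w.2).symm)⟩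
  have hrange : LinearMap.range φ = ⊤ := by
    refine LinearMap.range_eq_top.mpr (LinearMap.surjective ?_)
    intro h
    have : φ ⟨P.proj F.side, fun i hi => F.ortho.form_proj hi⟩ = 0 := by rw [h]; rfl
    have h2 : φ ⟨P.proj F.side, fun i hi => F.ortho.form_proj hi⟩ = -1 := F.form_proj
    rw [this] at h2
    norm_num at h2
  have := LinearMap.finrank_range_add_finrank_ker φ
  rw [hker, hrange, finrank_top, Module.finrank_self] at this
  exact this

/-- The members of `side` opposite to elements of `S`. -/
noncomputable def flipped (S : Finset ι) : Finset ι := F.side.filter fun i => F.opp i ∈ S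

/-- The value of a functional on the ray of the face at `v` pointing along the cube vertex `X`. -/
noncomputable def height (g : E →ₗ[ℝ] ℝ) (X : Finset ι) : ℝ :=
  g (P.proj F.side) - ∑ i ∈ X, F.scale i * g (P.normal i)

theorem apply_eq {g : E →ₗ[ℝ] ℝ} (hgv : g v = 0) (x : E) :
    g x = -P.form v x * g (P.proj F.side) +
      ∑ i ∈ F.side, P.form (P.normal i) x * g (P.normal i) := by
  set y := x - ((-P.form v x) • P.proj F.side +
    ∑ i ∈ F.side, P.form (P.normal i) x • P.normal i) with hy
  have h1 : y = (-P.form P.base y) • v := by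
    refine F.eq_smul (fun i hi => ?_) ?_
    · rw [hy, map_sub, map_add, F.ortho.form_sum (fun i => P.form (P.normal i) x) hi, map_smul,
        F.ortho.form_proj hi]
      simp
    · rw [hy, map_sub, map_add, map_smul, F.form_proj, map_sum, Finset.sum_eq_zero]
      · simp
      · intro i hi
        rw [map_smul, P.symm v, F.mem i hi, smul_zero]
  have h2 := congrArg g h1
  rw [map_smul, hgv, smul_zero, hy, map_sub, sub_eq_zero, map_add, map_sum] at h2
  simpa using h2

/-- The point of the face of the ideal vertex `v` in the direction of the cube vertex `X`. -/
theorem exists_mem_perp_of_cube {S X : Finset ι} (hX : X ⊆ F.side) (hS : S ⊆ P.active v)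
    (h0 : ∀ i ∈ F.side, i ∈ S → i ∉ X) (h1 : ∀ i ∈ F.side, F.opp i ∈ S → i ∈ X) :
    ∃ x ∈ P.cone, x ∈ P.perp S ∧ P.form v x < 0 ∧
      ∀ g : E →ₗ[ℝ] ℝ, g v = 0 → ∃ ε : ℝ, 0 < ε ∧ g x = ε * F.height g X := by
  set y := P.proj F.side - ∑ i ∈ X, F.scale i • P.normal i with hy
  have hvy : P.form v y = -1 := by
    rw [hy, map_sub, F.form_proj, map_sum, Finset.sum_eq_zero, sub_zero]
    intro i hi
    rw [map_smul, P.symm, F.mem i (hX hi), smul_zero]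
  have hyX : ∀ i ∈ F.side, P.form (P.normal i) y = if i ∈ X then -F.scale i else 0 := by
    intro i hi
    rw [hy, map_sub, F.ortho.form_proj hi]
    split_ifs with hiX
    · rw [(F.ortho.mono hX).form_sum F.scale hiX, zero_sub]
    · rw [map_sum, Finset.sum_eq_zero, sub_zero]
      intro j hj
      rw [map_smul, F.ortho i hi j (hX hj) (by rintro rfl; exact hiX hj), smul_zero]
  have hyo : ∀ i ∈ F.side, P.form (P.normal (F.opp i)) y = if i ∈ X then 0 else -F.scale i := by
    intro i hi
    rw [F.form_opp i hi, hvy, hyX i hi]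
    split_ifs <;> ring
  obtain ⟨ε, hε, hmem⟩ := exists_add_smul_mem_cone (d := y) F.mem_ideal.1 (by
    intro j hj
    rcases F.cover j hj with hj | ⟨i, hi, rfl⟩
    · rw [hyX j hj]
      split_ifs
      · linarith [F.scale_pos j hj]
      · exact le_rfl
    · rw [hyo i hi]
      split_ifs
      · exact le_rfl
      · linarith [F.scale_pos i hi])
  refine ⟨_, hmem, ?_, ?_, fun g hg => ⟨ε, hε, ?_⟩⟩
  · intro j hj
    have hjv := mem_active.mp (hS hj)
    rw [map_add, hjv, zero_add, map_smul]
    rcases F.cover j hjv with hj' | ⟨i, hi, rfl⟩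
    · rw [hyX j hj', if_neg (h0 j hj' hj), smul_zero]
    · rw [hyo i hi, if_pos (h1 i hi hj), smul_zero]
  · rw [map_add, F.mem_ideal.2.1, map_smul, hvy, smul_eq_mul]
    linarith
  · rw [map_add, hg, zero_add, map_smul, smul_eq_mul, hy, map_sub, map_sum, height]
    simp

theorem neg_scale_le {x : E} (hx : x ∈ P.cone) {i : ι} (hi : i ∈ F.side) :
    F.scale i * P.form v x ≤ P.form (P.normal i) x := by
  have := hx (F.opp i)
  rw [F.form_opp i hi] at this
  linarith

theorem height_mul_le {g : E →ₗ[ℝ] ℝ} (hgv : g v = 0) (hg : ∀ i ∈ F.side, g (P.normal i) < 0)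
    {S X : Finset ι} (hX : X ⊆ F.side) (h : ∀ i ∈ X, F.opp i ∈ S) {x : E}
    (hx : x ∈ P.cone) (hxS : x ∈ P.perp S) : -P.form v x * F.height g X ≤ g x := by
  rw [F.apply_eq hgv x, height, mul_sub, Finset.mul_sum, sub_eq_add_neg,
    ← Finset.sum_neg_distrib]
  refine add_le_add le_rfl ?_
  calc _ = ∑ i ∈ X, P.form (P.normal i) x * g (P.normal i) := by
        refine Finset.sum_congr rfl fun i hi => ?_
        have := hxS _ (h i hi)
        rw [F.form_opp i (hX hi)] at this
        rw [show P.form (P.normal i) x = F.scale i * P.form v x by linarith]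
        ring
    _ ≤ _ := Finset.sum_le_sum_of_subset_of_nonneg hX fun i hi _ =>
        mul_nonneg_of_nonpos_of_nonpos (hx i) (hg i hi).le

theorem le_height_mul {g : E →ₗ[ℝ] ℝ} (hgv : g v = 0) (hg : ∀ i ∈ F.side, g (P.normal i) < 0)
    {S X : Finset ι} (hX : X ⊆ F.side) (h : ∀ i ∈ F.side, i ∉ X → i ∈ S) {x : E}
    (hx : x ∈ P.cone) (hxS : x ∈ P.perp S) : g x ≤ -P.form v x * F.height g X := by
  rw [F.apply_eq hgv x, height, mul_sub, Finset.mul_sum, sub_eq_add_neg,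
    ← Finset.sum_neg_distrib]
  refine add_le_add le_rfl ?_
  calc _ = ∑ i ∈ X, P.form (P.normal i) x * g (P.normal i) := by
        refine (Finset.sum_subset hX fun i hi hiX => ?_).symm
        rw [hxS i (h i hi hiX), zero_mul]
    _ ≤ _ := by
        refine Finset.sum_le_sum fun i hi => ?_
        have h1 := F.neg_scale_le hx (hX hi)
        have h2 := hg i (hX hi)
        nlinarith

end Frame

end Local

end RightAngledSystem

/-- Counting ordered pairs of disjoint subsets by the complement of their union. -/
theorem card_disjoint_pairs {α : Type*} [DecidableEq α] (R : Finset α) (U : Finset α → Prop)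
    [DecidablePred U] {c k : ℕ} (hk : c + k = R.card) :
    ((R.powerset ×ˢ R.powerset).filter fun q =>
      Disjoint q.1 q.2 ∧ q.1.card + q.2.card = c ∧ U q.2).card =
    ∑ X ∈ R.powerset, if U X then (R.card - X.card).choose k else 0 := by
  rw [Finset.card_eq_sum_card_fiberwise (f := Prod.snd) (t := R.powerset)
    (fun q hq => (Finset.mem_product.mp (Finset.mem_filter.mp hq).1).2)]
  refine Finset.sum_congr rfl fun X hX => ?_
  have hXR := Finset.mem_powerset.mp hX
  split_ifs with hU
  · rw [← Finset.card_sdiff_of_subset hXR, ← Finset.card_powersetCard]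
    refine Finset.card_nbij' (fun q => (R \ X) \ q.1) (fun J => ((R \ X) \ J, X)) ?_ ?_ ?_ ?_
    · rintro ⟨a, b⟩ hq
      simp only [Finset.coe_filter, Finset.mem_filter, Finset.mem_product, Finset.mem_powerset,
        Set.mem_ofPred_eq] at hq
      obtain ⟨⟨⟨ha, -⟩, hd, hc, -⟩, rfl⟩ := hq
      have hsub : a ⊆ R \ b := Finset.subset_sdiff.mpr ⟨ha, hd⟩
      simp only [Finset.mem_coe, Finset.mem_powersetCard]
      refine ⟨Finset.sdiff_subset, ?_⟩
      rw [Finset.card_sdiff_of_subset hsub, Finset.card_sdiff_of_subset hXR]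
      omega
    · intro J hJ
      simp only [Finset.mem_coe, Finset.mem_powersetCard] at hJ
      simp only [Finset.coe_filter, Finset.mem_filter, Finset.mem_product, Finset.mem_powerset,
        Set.mem_ofPred_eq]
      refine ⟨⟨⟨Finset.sdiff_subset.trans Finset.sdiff_subset, hXR⟩,
        Finset.disjoint_of_subset_left Finset.sdiff_subset Finset.sdiff_disjoint, ?_, hU⟩, trivial⟩
      have h1 := Finset.card_le_card hJ.1
      have h2 := Finset.card_le_card hXR
      rw [Finset.card_sdiff_of_subset hJ.1]
      rw [Finset.card_sdiff_of_subset hXR] at h1 ⊢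
      omega
    · rintro ⟨a, b⟩ hq
      simp only [Finset.coe_filter, Finset.mem_filter, Finset.mem_product, Finset.mem_powerset,
        Set.mem_ofPred_eq] at hq
      obtain ⟨⟨⟨ha, -⟩, hd, hc, -⟩, rfl⟩ := hq
      have hsub : a ⊆ R \ b := Finset.subset_sdiff.mpr ⟨ha, hd⟩
      simp [Finset.inter_eq_right.mpr hsub]
    · intro J hJ
      simp only [Finset.mem_coe, Finset.mem_powersetCard] at hJ
      simp [Finset.inter_eq_right.mpr hJ.1]
  · rw [Finset.card_eq_zero, Finset.filter_eq_empty_iff]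
    rintro ⟨a, b⟩ hq rfl
    exact hU (Finset.mem_filter.mp hq).2.2.2

namespace RightAngledSystem

open scoped Classical

set_option linter.unusedSectionVars false

section Count

variable {ι E : Type} [Fintype ι] [NormedAddCommGroup E] [NormedSpace ℝ E]
  [FiniteDimensional ℝ E] {P : RightAngledSystem ι E}

variable (P) in
/-- The index sets of the faces of codimension `c`. -/
noncomputable def orthoSets (c : ℕ) : Finset (Finset ι) :=
  Finset.univ.filter fun S => P.IsOrtho S ∧ S.card = c

theorem mem_orthoSets {c : ℕ} {S : Finset ι} :
    S ∈ P.orthoSets c ↔ P.IsOrtho S ∧ S.card = c := by simp [orthoSets]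

namespace Frame

variable {v : E} (F : P.Frame v)

theorem mem_flipped {S : Finset ι} {i : ι} : i ∈ F.flipped S ↔ i ∈ F.side ∧ F.opp i ∈ S := by
  simp [flipped]

theorem side_subset_active : F.side ⊆ P.active v := fun i hi => mem_active.mpr (F.mem i hi)

section

variable {a b : Finset ι} (ha : a ⊆ F.side) (hb : b ⊆ F.side)

include ha hb

theorem isOrtho_union (hab : Disjoint a b) : P.IsOrtho (a ∪ b.image F.opp) := by
  intro i hi j hj hij
  rw [Finset.mem_union, Finset.mem_image] at hi hj
  rcases hi with hi | ⟨k, hk, rfl⟩ <;> rcases hj with hj | ⟨l, hl, rfl⟩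
  · exact F.ortho i (ha hi) j (ha hj) hij
  · exact F.form_opp_of_ne (ha hi) (hb hl) fun h => Finset.disjoint_left.mp hab hi (h ▸ hl)
  · rw [P.symm]
    exact F.form_opp_of_ne (ha hj) (hb hk) fun h => Finset.disjoint_left.mp hab hj (h ▸ hk)
  · exact F.form_opp_opp (hb hk) (hb hl) fun h => hij (h ▸ rfl)

theorem union_subset_active : a ∪ b.image F.opp ⊆ P.active v := by
  refine Finset.union_subset (ha.trans F.side_subset_active) fun i hi => ?_
  obtain ⟨k, hk, rfl⟩ := Finset.mem_image.mp hi
  exact mem_active.mpr (F.form_opp_base (hb hk))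

theorem card_union : (a ∪ b.image F.opp).card = a.card + b.card := by
  rw [Finset.card_union_of_disjoint, Finset.card_image_of_injOn (F.opp_injOn.mono hb)]
  rw [Finset.disjoint_right]
  intro i hi hia
  obtain ⟨k, hk, rfl⟩ := Finset.mem_image.mp hi
  exact F.opp_notMem (hb hk) (ha hia)

theorem union_inter_side : (a ∪ b.image F.opp) ∩ F.side = a := by
  ext i
  simp only [Finset.mem_inter, Finset.mem_union, Finset.mem_image]
  constructor
  · rintro ⟨h | ⟨k, hk, rfl⟩, h2⟩
    · exact h
    · exact absurd h2 (F.opp_notMem (hb hk))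
  · exact fun h => ⟨Or.inl h, ha h⟩

theorem flipped_union : F.flipped (a ∪ b.image F.opp) = b := by
  ext i
  simp only [mem_flipped, Finset.mem_union, Finset.mem_image]
  constructor
  · rintro ⟨hi, h | ⟨k, hk, h⟩⟩
    · exact absurd (ha h) (F.opp_notMem hi)
    · exact F.opp_injOn (hb hk) hi h ▸ hk
  · exact fun h => ⟨hb h, Or.inr ⟨i, h, rfl⟩⟩

end

theorem disjoint_flipped {S : Finset ι} (hS : P.IsOrtho S) :
    Disjoint (S ∩ F.side) (F.flipped S) := by
  rw [Finset.disjoint_left]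
  intro i hi hi'
  rw [Finset.mem_inter] at hi
  rw [mem_flipped] at hi'
  have := hS i hi.1 _ hi'.2 fun h => F.opp_notMem hi.2 (h ▸ hi.2)
  rw [F.form_opp_self hi.2] at this
  norm_num at this

theorem union_flipped {S : Finset ι} (hS : S ⊆ P.active v) :
    (S ∩ F.side) ∪ (F.flipped S).image F.opp = S := by
  ext i
  simp only [Finset.mem_union, Finset.mem_inter, Finset.mem_image, mem_flipped]
  constructor
  · rintro (h | ⟨k, hk, rfl⟩)
    · exact h.1
    · exact hk.2
  · intro h
    rcases F.cover i (mem_active.mp (hS h)) with hi | ⟨k, hk, rfl⟩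
    · exact Or.inl ⟨h, hi⟩
    · exact Or.inr ⟨k, ⟨hk, h⟩, rfl⟩

/-- The faces containing an ideal vertex correspond to pairs of disjoint subsets of `side`. -/
theorem card_orthoSets_filter (c : ℕ) (p : Finset ι → Finset ι → Prop)
    [∀ a b, Decidable (p a b)] :
    ((P.orthoSets c).filter fun S => S ⊆ P.active v ∧ p (S ∩ F.side) (F.flipped S)).card =
    ((F.side.powerset ×ˢ F.side.powerset).filter fun q =>
      Disjoint q.1 q.2 ∧ q.1.card + q.2.card = c ∧ p q.1 q.2).card := by
  refine Finset.card_nbij' (fun S => (S ∩ F.side, F.flipped S))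
    (fun q => q.1 ∪ q.2.image F.opp) ?_ ?_ ?_ ?_
  · intro S hS
    simp only [Finset.coe_filter, mem_orthoSets, Set.mem_ofPred_eq] at hS
    obtain ⟨⟨h1, h2⟩, h3, h4⟩ := hS
    simp only [Finset.coe_filter, Finset.mem_product, Finset.mem_powerset, Set.mem_ofPred_eq]
    refine ⟨⟨Finset.inter_subset_right, Finset.filter_subset _ _⟩, F.disjoint_flipped h1, ?_, h4⟩
    rw [← F.card_union (b := F.flipped S) Finset.inter_subset_right (Finset.filter_subset _ _),
      F.union_flipped h3, h2]
  · rintro ⟨a, b⟩ hq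
    simp only [Finset.coe_filter, Finset.mem_product, Finset.mem_powerset, Set.mem_ofPred_eq] at hq
    obtain ⟨⟨ha, hb⟩, hd, hc, hp⟩ := hq
    simp only [Finset.coe_filter, mem_orthoSets, Set.mem_ofPred_eq]
    refine ⟨⟨F.isOrtho_union ha hb hd, (F.card_union ha hb).trans hc⟩,
      F.union_subset_active ha hb, ?_⟩
    rwa [F.union_inter_side ha hb, F.flipped_union ha hb]
  · intro S hS
    simp only [Finset.coe_filter, Set.mem_ofPred_eq] at hS
    exact F.union_flipped hS.2.1
  · rintro ⟨a, b⟩ hq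
    simp only [Finset.coe_filter, Finset.mem_product, Finset.mem_powerset, Set.mem_ofPred_eq] at hq
    exact Prod.ext (F.union_inter_side hq.1.1 hq.1.2) (F.flipped_union hq.1.1 hq.1.2)

theorem height_ne_zero {f : E →ₗ[ℝ] ℝ} (hf : ∀ w ∈ P.vertices, f w = f v → w = v)
    (hg : ∀ i ∈ F.side, P.tilt f v (P.normal i) < 0) {X : Finset ι} (hX : X ⊆ F.side) :
    F.height (P.tilt f v) X ≠ 0 := by
  intro h0
  have hs : F.side \ X ⊆ F.side := Finset.sdiff_subset
  have hS := F.isOrtho_union hs hX Finset.sdiff_disjoint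
  have hgv := tilt_self (P := P) f (mem_slice_of_mem_ideal F.mem_ideal)
  set S := (F.side \ X) ∪ X.image F.opp with hSdef
  have hSi : ∀ i ∈ F.side, i ∉ X → i ∈ S := fun i hi hiX =>
    Finset.mem_union_left _ (Finset.mem_sdiff.mpr ⟨hi, hiX⟩)
  have hSo : ∀ i ∈ X, F.opp i ∈ S := fun i hi =>
    Finset.mem_union_right _ (Finset.mem_image_of_mem _ hi)
  obtain ⟨w, hw, hwS, hmin⟩ := exists_vertex_min hS (P.form v)
  obtain ⟨x, hx, hxS, hvx, -⟩ := F.exists_mem_perp_of_cube hX (F.union_subset_active hs hX)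
    (fun i hi hiS hiX => by
      have : i ∈ S ∩ F.side := Finset.mem_inter.mpr ⟨hiS, hi⟩
      rw [F.union_inter_side hs hX] at this
      exact (Finset.mem_sdiff.mp this).2 hiX)
    (fun i hi hiS => by
      have : i ∈ F.flipped S := F.mem_flipped.mpr ⟨hi, hiS⟩
      rwa [F.flipped_union hs hX] at this)
  have hbx : P.form P.base x < 0 := P.future x hx (by rintro rfl; simp at hvx)
  have h1 := hmin _ (normalize_mem_slice hx hbx) ((P.perp S).smul_mem _ hxS)
  have h2 : P.form v ((-P.form P.base x)⁻¹ • x) < 0 := by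
    rw [map_smul, smul_eq_mul]
    exact mul_neg_of_pos_of_neg (inv_pos.mpr (by linarith)) hvx
  have h3 := F.height_mul_le hgv hg hX hSo hw.1.1 hwS
  have h4 := F.le_height_mul hgv hg hX hSi hw.1.1 hwS
  rw [h0, mul_zero] at h3 h4
  have h5 : P.tilt f v w = 0 := le_antisymm h4 h3
  rw [tilt_apply, hw.1.2] at h5
  have h6 := hf w hw (by linarith)
  rw [h6, F.mem_ideal.2.1] at h1
  linarith

variable {f : E →ₗ[ℝ] ℝ} (hf : ∀ w ∈ P.vertices, f w = f v → w = v)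
  (hg : ∀ i ∈ F.side, P.tilt f v (P.normal i) < 0)

include hf hg

theorem isLowest_iff_height {S : Finset ι} (hS : P.IsOrtho S) :
    P.IsLowest f v S ↔ S ⊆ P.active v ∧ 0 < F.height (P.tilt f v) (F.flipped S) := by
  have hgv := tilt_self (P := P) f (mem_slice_of_mem_ideal F.mem_ideal)
  have hsub : F.flipped S ⊆ F.side := Finset.filter_subset _ _
  rw [isLowest_iff]
  refine and_congr_right fun hSA => ⟨fun h => ?_, fun h x hx hxS => ?_⟩
  · obtain ⟨x, hx, hxS, -, hval⟩ := F.exists_mem_perp_of_cube hsub hSA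
      (fun i hi hiS => Finset.disjoint_left.mp (F.disjoint_flipped hS)
        (Finset.mem_inter.mpr ⟨hiS, hi⟩))
      (fun i hi hiS => F.mem_flipped.mpr ⟨hi, hiS⟩)
    obtain ⟨ε, hε, he⟩ := hval _ hgv
    have := h x hx hxS
    rw [he] at this
    exact lt_of_le_of_ne (nonneg_of_mul_nonneg_right this hε) (F.height_ne_zero hf hg hsub).symm
  · have h1 := F.height_mul_le hgv hg hsub (fun i hi => (F.mem_flipped.mp hi).2) hx hxS
    have h2 := form_nonpos_of_mem_cone F.mem_ideal.1 F.mem_ideal.2.1 hx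
    exact le_trans (mul_nonneg (by linarith) h.le) h1

theorem isLowest_neg_iff_height {S : Finset ι} (hS : P.IsOrtho S) :
    P.IsLowest (-f) v S ↔
      S ⊆ P.active v ∧ ¬ 0 < F.height (P.tilt f v) (F.side \ (S ∩ F.side)) := by
  have hgv := tilt_self (P := P) f (mem_slice_of_mem_ideal F.mem_ideal)
  have hsub : F.side \ (S ∩ F.side) ⊆ F.side := Finset.sdiff_subset
  rw [isLowest_iff]
  refine and_congr_right fun hSA => ⟨fun h => ?_, fun h x hx hxS => ?_⟩
  · obtain ⟨x, hx, hxS, -, hval⟩ := F.exists_mem_perp_of_cube hsub hSA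
      (fun i hi hiS hiX => (Finset.mem_sdiff.mp hiX).2 (Finset.mem_inter.mpr ⟨hiS, hi⟩))
      (fun i hi hiS => Finset.mem_sdiff.mpr ⟨hi, fun hi' =>
        Finset.disjoint_left.mp (F.disjoint_flipped hS) hi' (F.mem_flipped.mpr ⟨hi, hiS⟩)⟩)
    obtain ⟨ε, hε, he⟩ := hval _ hgv
    have := h x hx hxS
    rw [tilt_neg, he] at this
    intro hpos
    nlinarith [mul_pos hε hpos]
  · have h1 := F.le_height_mul hgv hg hsub (fun i hi hiX => by
      by_contra hiS
      exact hiX (Finset.mem_sdiff.mpr ⟨hi, fun h => hiS (Finset.mem_inter.mp h).1⟩)) hx hxS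
    have h2 := form_nonpos_of_mem_cone F.mem_ideal.1 F.mem_ideal.2.1 hx
    rw [tilt_neg]
    nlinarith [not_lt.mp h]

/-- The number of faces on which an ideal vertex is lowest or highest. -/
theorem card_isLowest_add {c k : ℕ} (hk : c + k = F.side.card) :
    ((P.orthoSets c).filter (P.IsLowest f v)).card +
      ((P.orthoSets c).filter (P.IsLowest (-f) v)).card =
    ∑ X ∈ F.side.powerset, if 0 < F.height (P.tilt f v) X
      then (F.side.card - X.card).choose k else X.card.choose k := by
  have h1 : (P.orthoSets c).filter (P.IsLowest f v) = (P.orthoSets c).filter fun S =>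
      S ⊆ P.active v ∧ 0 < F.height (P.tilt f v) (F.flipped S) :=
    Finset.filter_congr fun S hS => F.isLowest_iff_height hf hg (mem_orthoSets.mp hS).1
  have h2 : (P.orthoSets c).filter (P.IsLowest (-f) v) = (P.orthoSets c).filter fun S =>
      S ⊆ P.active v ∧ ¬ 0 < F.height (P.tilt f v) (F.side \ (S ∩ F.side)) :=
    Finset.filter_congr fun S hS => F.isLowest_neg_iff_height hf hg (mem_orthoSets.mp hS).1
  rw [h1, h2, F.card_orthoSets_filter c fun _ b => 0 < F.height (P.tilt f v) b,
    F.card_orthoSets_filter c fun a _ => ¬ 0 < F.height (P.tilt f v) (F.side \ a),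
    card_disjoint_pairs F.side (fun b => 0 < F.height (P.tilt f v) b) hk]
  have h3 : ((F.side.powerset ×ˢ F.side.powerset).filter fun q => Disjoint q.1 q.2 ∧
      q.1.card + q.2.card = c ∧ ¬ 0 < F.height (P.tilt f v) (F.side \ q.1)).card =
      ((F.side.powerset ×ˢ F.side.powerset).filter fun q => Disjoint q.1 q.2 ∧
      q.1.card + q.2.card = c ∧ ¬ 0 < F.height (P.tilt f v) (F.side \ q.2)).card := by
    refine Finset.card_nbij' Prod.swap Prod.swap ?_ ?_ (fun _ _ => rfl) (fun _ _ => rfl) <;>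
    · rintro ⟨a, b⟩ hq
      simp only [Finset.coe_filter, Finset.mem_product, Set.mem_ofPred_eq, Prod.fst_swap,
        Prod.snd_swap] at hq ⊢
      exact ⟨hq.1.symm, hq.2.1.symm, by rw [add_comm]; exact hq.2.2.1, hq.2.2.2⟩
  rw [h3, card_disjoint_pairs F.side (fun b => ¬ 0 < F.height (P.tilt f v) (F.side \ b)) hk]
  have h4 : (∑ X ∈ F.side.powerset, if ¬ 0 < F.height (P.tilt f v) (F.side \ X)
      then (F.side.card - X.card).choose k else 0) =
      ∑ X ∈ F.side.powerset, if ¬ 0 < F.height (P.tilt f v) X then X.card.choose k else 0 := by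
    refine Finset.sum_nbij' (F.side \ ·) (F.side \ ·) ?_ ?_ ?_ ?_ ?_
    · exact fun X _ => Finset.mem_powerset.mpr Finset.sdiff_subset
    · exact fun X _ => Finset.mem_powerset.mpr Finset.sdiff_subset
    · exact fun X hX => Finset.sdiff_sdiff_eq_self (Finset.mem_powerset.mp hX)
    · exact fun X hX => Finset.sdiff_sdiff_eq_self (Finset.mem_powerset.mp hX)
    · intro X hX
      rw [Finset.card_sdiff_of_subset (Finset.mem_powerset.mp hX)]
  rw [h4, ← Finset.sum_add_distrib]
  refine Finset.sum_congr rfl fun X _ => ?_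
  split_ifs <;> simp

end Frame

/-- The number of faces of given dimension on which a finite vertex is lowest. -/
theorem card_isLowest_of_neg {f : E →ₗ[ℝ] ℝ} {v : E} (hv : v ∈ P.vertices)
    (hneg : P.form v v < 0) (hf : ∀ i ∈ P.active v, P.tilt f v (P.normal i) ≠ 0)
    {c k : ℕ} (hk : c + k = (P.active v).card) :
    ((P.orthoSets c).filter (P.IsLowest f v)).card =
      ((P.active v).filter fun i => P.tilt f v (P.normal i) < 0).card.choose k := by
  rw [← Finset.card_powersetCard]
  have hsub : ((P.active v).filter fun i => P.tilt f v (P.normal i) < 0) ⊆ P.active v :=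
    Finset.filter_subset _ _
  refine Finset.card_nbij' (P.active v \ ·) (P.active v \ ·) ?_ ?_ ?_ ?_
  · intro S hS
    simp only [Finset.coe_filter, mem_orthoSets, Set.mem_ofPred_eq,
      isLowest_iff_of_neg hv hneg hf] at hS
    obtain ⟨⟨-, h1⟩, h2, h3⟩ := hS
    simp only [Finset.mem_coe, Finset.mem_powersetCard]
    refine ⟨fun i hi => ?_, ?_⟩
    · rw [Finset.mem_sdiff] at hi
      exact Finset.mem_filter.mpr ⟨hi.1, h3 i hi.1 hi.2⟩
    · rw [Finset.card_sdiff_of_subset h2]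
      omega
  · intro T hT
    simp only [Finset.mem_coe, Finset.mem_powersetCard] at hT
    simp only [Finset.coe_filter, mem_orthoSets, Set.mem_ofPred_eq,
      isLowest_iff_of_neg hv hneg hf]
    refine ⟨⟨(isOrtho_active hv.1 hneg).mono Finset.sdiff_subset, ?_⟩, Finset.sdiff_subset, ?_⟩
    · rw [Finset.card_sdiff_of_subset (hT.1.trans hsub)]
      omega
    · intro i hi hiT
      have : i ∈ T := by
        by_contra h
        exact hiT (Finset.mem_sdiff.mpr ⟨hi, h⟩)
      exact (Finset.mem_filter.mp (hT.1 this)).2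
  · intro S hS
    exact Finset.sdiff_sdiff_eq_self (Finset.mem_filter.mp hS).2.1
  · intro T hT
    simp only [Finset.mem_coe, Finset.mem_powersetCard] at hT
    exact Finset.sdiff_sdiff_eq_self (hT.1.trans hsub)

end Count

section Sweep

variable {ι E : Type} [Fintype ι] [NormedAddCommGroup E] [NormedSpace ℝ E]
  [FiniteDimensional ℝ E] {P : RightAngledSystem ι E}

variable (P) in
theorem exists_generic : ∃ f : E →ₗ[ℝ] ℝ, Set.InjOn f P.vertices ∧
    ∀ v ∈ P.vertices, ∀ i, P.form (P.normal i) v = 0 → P.tilt f v (P.normal i) ≠ 0 := by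
  have : Finite P.vertices := P.vertices_finite.to_subtype
  obtain ⟨f, hf⟩ := Module.exists_dual_forall_apply_ne_zero (K := ℝ)
    (ι := {p : P.vertices × P.vertices // p.1 ≠ p.2} ⊕
      {p : P.vertices × ι // P.form (P.normal p.2) p.1 = 0})
    (Sum.elim (fun p => (p.1.1 : E) - p.1.2)
      fun p => P.normal p.1.2 + P.form P.base (P.normal p.1.2) • (p.1.1 : E)) (by
    rintro (⟨⟨v, w⟩, h⟩ | ⟨⟨v, i⟩, h⟩)
    · simpa [sub_eq_zero, Subtype.ext_iff] using h
    · intro h0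
      have := congrArg (P.form (P.normal i)) h0
      simp [P.unit, show P.form (P.normal i) v = 0 from h] at this)
  refine ⟨f, fun v hv w hw h => ?_, fun v hv i hi => ?_⟩
  · by_contra hne
    have := hf (Sum.inl ⟨(⟨v, hv⟩, ⟨w, hw⟩), fun h => hne (congrArg Subtype.val h)⟩)
    simp [h] at this
  · have := hf (Sum.inr ⟨(⟨v, hv⟩, i), hi⟩)
    rw [tilt_apply]
    simpa [mul_comm] using this

variable (P) in
/-- The finite set of all vertices. -/
noncomputable def vertexFinset : Finset E := P.vertices_finite.toFinset

variable (P) in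
/-- The finite set of ideal vertices. -/
noncomputable def idealFinset : Finset E := P.ideal_finite.toFinset

theorem mem_vertexFinset {v : E} : v ∈ P.vertexFinset ↔ v ∈ P.vertices := by simp [vertexFinset]

theorem mem_idealFinset {v : E} : v ∈ P.idealFinset ↔ v ∈ P.ideal := by simp [idealFinset]

theorem idealFinset_subset : P.idealFinset ⊆ P.vertexFinset := fun _ hv =>
  mem_vertexFinset.mpr (mem_vertices_of_mem_ideal (mem_idealFinset.mp hv))

theorem mem_sdiff_ideal {v : E} :
    v ∈ P.vertexFinset \ P.idealFinset ↔ v ∈ P.vertices ∧ P.form v v < 0 := by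
  rw [Finset.mem_sdiff, mem_vertexFinset, mem_idealFinset]
  refine and_congr_right fun hv => ?_
  have := P.causal v hv.1.1
  constructor
  · exact fun h => lt_of_le_of_ne this fun h0 => h ⟨hv.1.1, h0, hv.1.2⟩
  · exact fun h h0 => h.ne h0.2.1

theorem card_orthoSets_eq_sum {f : E →ₗ[ℝ] ℝ} (hf : Set.InjOn f P.vertices) (c : ℕ) :
    (P.orthoSets c).card =
      ∑ v ∈ P.vertexFinset, ((P.orthoSets c).filter (P.IsLowest f v)).card := by
  have := Finset.sum_card_bipartiteAbove_eq_sum_card_bipartiteBelow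
    (s := P.orthoSets c) (t := P.vertexFinset) (fun S v => P.IsLowest f v S)
  rw [Finset.card_eq_sum_ones]
  refine Eq.trans ?_ this
  refine Finset.sum_congr rfl fun S hS => ?_
  obtain ⟨v, hv, hvS, hmin⟩ := exists_vertex_min (mem_orthoSets.mp hS).1 f
  symm
  rw [Finset.card_eq_one]
  refine ⟨v, Finset.eq_singleton_iff_unique_mem.mpr ⟨?_, fun w hw => ?_⟩⟩
  · exact Finset.mem_filter.mpr ⟨mem_vertexFinset.mpr hv,
      fun i hi => mem_active.mpr (hvS i hi), hmin⟩
  · obtain ⟨hwV, hwS, hwmin⟩ := Finset.mem_filter.mp hw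
    rw [mem_vertexFinset] at hwV
    refine hf hwV hv (le_antisymm (hwmin v hv.1 hvS) (hmin w hwV.1 fun i hi => ?_))
    exact mem_active.mp (hwS hi)

/-- The Euler-type inequality obtained by sweeping the polyhedron with a generic functional. -/
theorem sweep {m : ℕ} (hE : Module.finrank ℝ E = m + 2) (c : ℕ → ℤ) (A : ℤ) (l : ℕ → ℤ)
    (hA : ∀ u ≤ m + 1,
      A ≤ ∑ k ∈ Finset.range (m + 1), c k * (u.choose (k + 1) + (m + 1 - u).choose (k + 1)))
    (hl : ∀ i ≤ m, l i ≤ ∑ k ∈ Finset.range (m + 1), c k * i.choose k ∧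
      l i ≤ ∑ k ∈ Finset.range (m + 1), c k * (m - i).choose k) :
    (P.vertexFinset \ P.idealFinset).card * A +
      P.idealFinset.card * (∑ i ∈ Finset.range (m + 1), m.choose i * l i) ≤
    2 * ∑ k ∈ Finset.range (m + 1), c k * (P.orthoSets (m - k)).card := by
  obtain ⟨f, hinj, hgen⟩ := P.exists_generic
  have hinj' : Set.InjOn (-f) P.vertices := fun v hv w hw h => hinj hv hw (by simpa using h)
  have hcount : 2 * ∑ k ∈ Finset.range (m + 1), c k * ((P.orthoSets (m - k)).card : ℤ) =
      ∑ v ∈ P.vertexFinset, ∑ k ∈ Finset.range (m + 1), c k *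
        (((P.orthoSets (m - k)).filter (P.IsLowest f v)).card +
          ((P.orthoSets (m - k)).filter (P.IsLowest (-f) v)).card : ℕ) := by
    rw [Finset.sum_comm, Finset.mul_sum]
    refine Finset.sum_congr rfl fun k _ => ?_
    rw [← Finset.mul_sum, ← Nat.cast_sum, Finset.sum_add_distrib, ← card_orthoSets_eq_sum hinj,
      ← card_orthoSets_eq_sum hinj']
    push_cast
    ring
  rw [hcount, ← Finset.sum_sdiff idealFinset_subset, ← nsmul_eq_mul, ← nsmul_eq_mul]
  refine add_le_add (Finset.card_nsmul_le_sum _ _ _ fun v hv => ?_)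
    (Finset.card_nsmul_le_sum _ _ _ fun v hv => ?_)
  · obtain ⟨hv, hneg⟩ := mem_sdiff_ideal.mp hv
    have hcard : (P.active v).card = m + 1 := by have := card_active hv hneg; omega
    have hgv : ∀ i ∈ P.active v, P.tilt f v (P.normal i) ≠ 0 := fun i hi =>
      hgen v hv i (mem_active.mp hi)
    have hgv' : ∀ i ∈ P.active v, P.tilt (-f) v (P.normal i) ≠ 0 := fun i hi => by
      rw [tilt_neg, neg_ne_zero]
      exact hgv i hi
    set D := (P.active v).filter fun i => P.tilt f v (P.normal i) < 0 with hD
    have hD' : (P.active v).filter (fun i => P.tilt (-f) v (P.normal i) < 0) =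
        P.active v \ D := by
      ext i
      simp only [hD, Finset.mem_filter, Finset.mem_sdiff, tilt_neg]
      constructor
      · rintro ⟨h1, h2⟩
        exact ⟨h1, fun h => by linarith [h.2]⟩
      · rintro ⟨h1, h2⟩
        refine ⟨h1, ?_⟩
        have h3 : ¬ P.tilt f v (P.normal i) < 0 := fun h => h2 ⟨h1, h⟩
        have := lt_of_le_of_ne (not_lt.mp h3) (hgv i h1).symm
        linarith
    have hDs : D ⊆ P.active v := Finset.filter_subset _ _
    refine (hA D.card (by rw [← hcard]; exact Finset.card_le_card hDs)).trans_eq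
      (Finset.sum_congr rfl fun k hk => ?_)
    have hk' : m - k + (k + 1) = (P.active v).card := by
      have := Finset.mem_range.mp hk
      omega
    rw [card_isLowest_of_neg hv hneg hgv hk', card_isLowest_of_neg hv hneg hgv' hk', hD',
      Finset.card_sdiff_of_subset hDs, hcard]
    push_cast
    rfl
  · have hv := mem_idealFinset.mp hv
    have hvV := mem_vertices_of_mem_ideal hv
    obtain ⟨F, hF⟩ := exists_frame hv (tilt_self f hvV.1) (hgen v hvV)
    have hcard : F.side.card = m := by have := F.card_side; omega
    have hsum : ∀ k ∈ Finset.range (m + 1), c k *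
        ((((P.orthoSets (m - k)).filter (P.IsLowest f v)).card +
          ((P.orthoSets (m - k)).filter (P.IsLowest (-f) v)).card : ℕ) : ℤ) =
        ∑ X ∈ F.side.powerset, if 0 < F.height (P.tilt f v) X
          then c k * (m - X.card).choose k else c k * X.card.choose k := by
      intro k hk
      rw [F.card_isLowest_add (fun w hw h => hinj hw hvV h) hF (k := k)
        (by have := Finset.mem_range.mp hk; omega), Nat.cast_sum, Finset.mul_sum, hcard]
      refine Finset.sum_congr rfl fun X _ => ?_
      split_ifs <;> rfl
    rw [Finset.sum_congr rfl hsum, Finset.sum_comm]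
    have hpow := Finset.sum_powerset_apply_card l (x := F.side)
    rw [hcard] at hpow
    simp only [nsmul_eq_mul] at hpow
    rw [← hpow]
    refine Finset.sum_le_sum fun X hX => ?_
    have hXm : X.card ≤ m := hcard ▸ Finset.card_le_card (Finset.mem_powerset.mp hX)
    split_ifs
    · exact (hl _ hXm).2
    · exact (hl _ hXm).1

theorem exists_frame_of_mem_ideal {v : E} (hv : v ∈ P.ideal) : Nonempty (P.Frame v) := by
  obtain ⟨f, -, hgen⟩ := P.exists_generic
  have hvV := mem_vertices_of_mem_ideal hv
  obtain ⟨F, -⟩ := exists_frame hv (tilt_self f hvV.1) (hgen v hvV)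
  exact ⟨F⟩

/-- Counting incidences of ideal vertices with faces of codimension `c`. -/
theorem sum_card_ideal {m c : ℕ} (hE : Module.finrank ℝ E = m + 2) (hc : c ≤ m) :
    ∑ S ∈ P.orthoSets c, (P.idealFinset.filter fun z => z ∈ P.perp S).card =
      P.idealFinset.card * ∑ i ∈ Finset.range (m + 1), m.choose i * (m - i).choose (m - c) := by
  have := Finset.sum_card_bipartiteAbove_eq_sum_card_bipartiteBelow
    (s := P.orthoSets c) (t := P.idealFinset) (fun S z => z ∈ P.perp S)
  refine this.trans (Finset.sum_const_nat fun z hz => ?_)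
  obtain ⟨F⟩ := exists_frame_of_mem_ideal (mem_idealFinset.mp hz)
  have hcard : F.side.card = m := by have := F.card_side; omega
  have h1 : Finset.bipartiteBelow (fun S z => z ∈ P.perp S) (P.orthoSets c) z =
      (P.orthoSets c).filter fun S => S ⊆ P.active z ∧ True := by
    refine Finset.filter_congr fun S _ => ?_
    rw [and_true]
    exact ⟨fun h i hi => mem_active.mpr (h i hi), fun h i hi => mem_active.mp (h hi)⟩
  rw [h1, F.card_orthoSets_filter c fun _ _ => True,
    card_disjoint_pairs F.side (fun _ => True) (k := m - c) (by omega)]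
  simp only [if_true, hcard]
  have hpow := Finset.sum_powerset_apply_card (fun i => (m - i).choose (m - c)) (x := F.side)
  rw [hcard] at hpow
  simpa using hpow

end Sweep

section Bounds

variable {ι E : Type} [Fintype ι] [NormedAddCommGroup E] [NormedSpace ℝ E]
  [FiniteDimensional ℝ E] {P : RightAngledSystem ι E}

theorem card_orthoSets_zero : (P.orthoSets 0).card = 1 := by
  rw [Finset.card_eq_one]
  refine ⟨∅, ?_⟩
  ext S
  simp only [mem_orthoSets, Finset.card_eq_zero, Finset.mem_singleton]
  refine ⟨fun h => h.2, ?_⟩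
  rintro rfl
  exact ⟨fun i hi => by simp at hi, rfl⟩

theorem isOrtho_singleton (i : ι) : P.IsOrtho {i} := by
  intro j hj k hk hjk
  rw [Finset.mem_singleton] at hj hk
  exact absurd (hj.trans hk.symm) hjk

theorem card_link (S : Finset ι) : Fintype.card (P.Link S) =
    (Finset.univ.filter fun j => ∀ i ∈ S, P.form (P.normal i) (P.normal j) = 0).card :=
  Fintype.card_subtype _

theorem sum_card_link (c : ℕ) :
    ∑ S ∈ P.orthoSets c, Fintype.card (P.Link S) = (P.orthoSets (c + 1)).card * (c + 1) := by
  rw [Finset.sum_congr rfl fun S _ => card_link (P := P) S, ← Finset.card_sigma]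
  rw [← Finset.sum_const_nat (f := fun T : Finset ι => T.card)
    (fun T hT => (mem_orthoSets.mp hT).2), ← Finset.card_sigma]
  refine Finset.card_nbij' (fun p => ⟨insert p.2 p.1, p.2⟩) (fun p => ⟨p.1.erase p.2, p.2⟩)
    ?_ ?_ ?_ ?_
  · rintro ⟨S, j⟩ h
    simp only [Finset.mem_coe, Finset.mem_sigma, mem_orthoSets, Finset.mem_filter,
      Finset.mem_univ, true_and] at h ⊢
    obtain ⟨⟨hS, hc⟩, hj⟩ := h
    have hjS : j ∉ S := fun h => by simpa [P.unit] using hj j h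
    refine ⟨⟨?_, by rw [Finset.card_insert_of_notMem hjS, hc]⟩, Finset.mem_insert_self _ _⟩
    intro a ha b hb hab
    rcases Finset.mem_insert.mp ha with ha | ha <;> rcases Finset.mem_insert.mp hb with hb | hb
    · exact absurd (ha.trans hb.symm) hab
    · rw [P.symm, ha]; exact hj b hb
    · rw [hb]; exact hj a ha
    · exact hS a ha b hb hab
  · rintro ⟨T, j⟩ h
    simp only [Finset.mem_coe, Finset.mem_sigma, mem_orthoSets, Finset.mem_filter,
      Finset.mem_univ, true_and] at h ⊢
    obtain ⟨⟨hT, hc⟩, hj⟩ := h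
    refine ⟨⟨hT.mono (Finset.erase_subset _ _), by rw [Finset.card_erase_of_mem hj, hc]; rfl⟩, ?_⟩
    intro i hi
    rw [Finset.mem_erase] at hi
    exact hT i hi.2 j hj hi.1
  · rintro ⟨S, j⟩ h
    simp only [Finset.mem_coe, Finset.mem_sigma, Finset.mem_filter,
      Finset.mem_univ, true_and] at h
    have hjS : j ∉ S := fun h' => by simpa [P.unit] using h.2 j h'
    simp [Finset.erase_insert hjS]
  · rintro ⟨T, j⟩ h
    simp only [Finset.mem_coe, Finset.mem_sigma] at h
    simp [Finset.insert_erase h.2]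

theorem card_orthoSets_one : (P.orthoSets 1).card = Fintype.card ι := by
  have h := sum_card_link (P := P) 0
  rw [Finset.sum_congr rfl fun S _ => card_link (P := P) S] at h
  have h0 : P.orthoSets 0 = {∅} := by
    ext S
    simp only [mem_orthoSets, Finset.card_eq_zero, Finset.mem_singleton]
    refine ⟨fun h => h.2, ?_⟩
    rintro rfl
    exact ⟨fun i hi => by simp at hi, rfl⟩
  rw [h0] at h
  simpa using h.symm

theorem card_ideal_face {S : Finset ι} (hS : P.IsOrtho S)
    (hdim : S.card + 3 ≤ Module.finrank ℝ E) :
    (P.face hS hdim).idealFinset.card = (P.idealFinset.filter fun z => z ∈ P.perp S).card := by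
  refine Finset.card_bij (fun z _ => (z : E)) ?_ ?_ ?_
  · intro z hz
    exact Finset.mem_filter.mpr ⟨mem_idealFinset.mpr
      ((mem_ideal_face hS hdim z).mp (mem_idealFinset.mp hz)), z.2⟩
  · exact fun _ _ _ _ h => Subtype.ext h
  · intro z hz
    obtain ⟨h1, h2⟩ := Finset.mem_filter.mp hz
    exact ⟨⟨z, h2⟩, mem_idealFinset.mpr ((mem_ideal_face hS hdim ⟨z, h2⟩).mpr
      (mem_idealFinset.mp h1)), rfl⟩

theorem nonempty_index (P : RightAngledSystem ι E) (hE : 3 ≤ Module.finrank ℝ E) : Nonempty ι := by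
  by_contra h
  rw [not_nonempty_iff] at h
  obtain ⟨d, -, hd0, -, hd⟩ := exists_mem_perp (P := P) (S := ∅) (by simpa using hE) 0 P.base
  exact absurd (P.causal d fun i => h.elim i) (not_le.mpr (P.pos d hd hd0))

/-- Each ideal vertex of a facet comes with a further facet parallel to it. -/
theorem card_facet (i : ι) :
    1 + Fintype.card (P.Link {i}) + (P.idealFinset.filter fun z => z ∈ P.perp {i}).card ≤
      Fintype.card ι := by
  have hz : ∀ z ∈ P.idealFinset.filter fun z => z ∈ P.perp {i}, z ∈ P.ideal ∧
      P.form (P.normal i) z = 0 := by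
    intro z hz
    obtain ⟨h1, h2⟩ := Finset.mem_filter.mp hz
    exact ⟨mem_idealFinset.mp h1, h2 i (Finset.mem_singleton_self i)⟩
  have : Nonempty ι := ⟨i⟩
  choose! o ho c hc hsum using fun (z : E) (h : z ∈ P.ideal ∧ P.form (P.normal i) z = 0) =>
    exists_opp (P := P) h.1 h.2
  have hform : ∀ z ∈ P.idealFinset.filter fun z => z ∈ P.perp {i},
      P.form (P.normal i) (P.normal (o z)) = -1 := by
    intro z h
    have := congrArg (P.form (P.normal i)) (hsum z (hz z h))
    rw [map_add, map_smul, (hz z h).2, P.unit, smul_zero] at this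
    linarith
  have hinj : Set.InjOn o (↑(P.idealFinset.filter fun z => z ∈ P.perp {i}) : Set E) := by
    intro z h w h' heq
    have h1 := hsum z (hz z h)
    rw [heq, hsum w (hz w h')] at h1
    have h2 := congrArg (P.form P.base) h1
    rw [map_smul, map_smul, (hz z h).1.2.2, (hz w h').1.2.2] at h2
    have h3 : c w = c z := by simpa using h2
    rw [h3] at h1
    exact (smul_right_injective E (hc z (hz z h)).ne' h1).symm
  rw [card_link, ← Finset.card_image_of_injOn hinj, ← Finset.card_singleton i,
    ← Finset.card_union_of_disjoint, ← Finset.card_union_of_disjoint]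
  · exact Finset.card_le_univ _
  · rw [Finset.disjoint_right]
    intro j hj hj'
    obtain ⟨z, h, rfl⟩ := Finset.mem_image.mp hj
    have := hform z h
    rcases Finset.mem_union.mp hj' with h' | h'
    · rw [Finset.mem_singleton.mp h', P.unit] at this
      norm_num at this
    · rw [(Finset.mem_filter.mp h').2 i (Finset.mem_singleton_self i)] at this
      norm_num at this
  · rw [Finset.disjoint_singleton_left]
    intro h
    have := (Finset.mem_filter.mp h).2 i (Finset.mem_singleton_self i)
    rw [P.unit] at this
    norm_num at this

theorem IsOrtho.card_lt {S : Finset ι} (hS : P.IsOrtho S) : S.card < Module.finrank ℝ E := by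
  rw [← finrank_perp hS]
  have : Nontrivial (P.perp S) := by
    refine ⟨⟨⟨P.proj S, fun i hi => hS.form_proj hi⟩, 0, fun h => ?_⟩⟩
    have h1 : P.proj S = 0 := congrArg Subtype.val h
    have := P.form_proj_self hS
    simp [h1] at this
  have := Module.finrank_pos (R := ℝ) (M := P.perp S)
  omega

end Bounds

section Polygon

variable {ι E : Type} [Fintype ι] [NormedAddCommGroup E] [NormedSpace ℝ E]
  [FiniteDimensional ℝ E] {P : RightAngledSystem ι E}

/-- A side of a polygon has at least two vertices. -/
theorem two_le_card_vertices (hE : Module.finrank ℝ E = 3) (i : ι) :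
    2 ≤ (P.vertexFinset.filter fun v => v ∈ P.perp {i}).card := by
  have hS := P.isOrtho_singleton i
  set q := (-P.form P.base (P.proj {i}))⁻¹ • P.proj {i} with hq
  have hbp := P.form_base_proj_neg hS
  have hqs : q ∈ P.slice := normalize_mem_slice (P.proj_mem_cone hS) hbp
  have hqS : q ∈ P.perp {i} := (P.perp {i}).smul_mem _ fun i hi => hS.form_proj hi
  have hqv : q ∉ P.vertices := by
    intro h
    have hneg : P.form q q < 0 := by
      have h0 := P.form_proj_self hS
      have h1 : 0 < (-P.form P.base (P.proj {i}))⁻¹ := inv_pos.mpr (by linarith)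
      rw [hq, map_smul, map_smul, LinearMap.smul_apply, smul_eq_mul, smul_eq_mul]
      exact mul_neg_of_pos_of_neg h1 (mul_neg_of_pos_of_neg h1 h0)
    have h2 := card_active h hneg
    have h3 : P.active q ⊆ {i} := by
      intro j hj
      by_contra hji
      have h4 := mem_active.mp hj
      rw [hq, map_smul, smul_eq_mul] at h4
      rcases mul_eq_zero.mp h4 with h4 | h4
      · rw [inv_eq_zero] at h4
        linarith
      · exact (P.form_proj_lt hji).ne h4
    have := Finset.card_le_card h3
    rw [Finset.card_singleton] at this
    omega
  obtain ⟨v, hv, hvS, -⟩ := exists_vertex_min hS (0 : E →ₗ[ℝ] ℝ)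
  obtain ⟨f, hf⟩ := Module.exists_dual_forall_apply_ne_zero (K := ℝ) (ι := Unit)
    (fun _ => q - v) (fun _ h => hqv (sub_eq_zero.mp h ▸ hv))
  have hf' : f q ≠ f v := by
    have := hf ()
    rwa [map_sub, sub_ne_zero] at this
  have key : ∃ w ∈ P.vertices, w ∈ P.perp {i} ∧ w ≠ v := by
    rcases lt_or_gt_of_ne hf' with h | h
    · obtain ⟨w, hw, hwS, hmin⟩ := exists_vertex_min hS f
      exact ⟨w, hw, hwS, by rintro rfl; linarith [hmin q hqs hqS]⟩
    · obtain ⟨w, hw, hwS, hmin⟩ := exists_vertex_min hS (-f)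
      refine ⟨w, hw, hwS, ?_⟩
      rintro rfl
      have := hmin q hqs hqS
      simp only [LinearMap.neg_apply] at this
      linarith
  obtain ⟨w, hw, hwS, hwv⟩ := key
  exact Finset.one_lt_card.mpr ⟨w, Finset.mem_filter.mpr ⟨mem_vertexFinset.mpr hw, hwS⟩,
    v, Finset.mem_filter.mpr ⟨mem_vertexFinset.mpr hv, hvS⟩, hwv⟩

theorem two_le_card_link (hE : Module.finrank ℝ E = 3) (i : ι) :
    2 ≤ Fintype.card (P.Link {i}) + (P.idealFinset.filter fun z => z ∈ P.perp {i}).card := by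
  refine (two_le_card_vertices (P := P) hE i).trans ?_
  have hsplit : (P.vertexFinset.filter fun v => v ∈ P.perp {i}) ⊆
      ((P.vertexFinset \ P.idealFinset).filter fun v => v ∈ P.perp {i}) ∪
        (P.idealFinset.filter fun v => v ∈ P.perp {i}) := by
    intro v hv
    rw [Finset.mem_filter] at hv
    simp only [Finset.mem_union, Finset.mem_filter, Finset.mem_sdiff]
    tauto
  refine (Finset.card_le_card hsplit).trans ((Finset.card_union_le _ _).trans
    (add_le_add ?_ le_rfl))
  rw [card_link, ← Nat.choose_one_right (Finset.card (Finset.univ.filter _)),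
    ← Finset.card_powersetCard]
  have hmem : ∀ v ∈ (P.vertexFinset \ P.idealFinset).filter fun v => v ∈ P.perp {i},
      v ∈ P.vertices ∧ P.form v v < 0 ∧ i ∈ P.active v := by
    intro v hv
    obtain ⟨h1, h2⟩ := Finset.mem_filter.mp hv
    obtain ⟨h3, h4⟩ := mem_sdiff_ideal.mp h1
    exact ⟨h3, h4, mem_active.mpr (h2 i (Finset.mem_singleton_self i))⟩
  refine Finset.card_le_card_of_injOn (fun v => (P.active v).erase i) ?_ ?_
  · intro v hv
    obtain ⟨h1, h2, h3⟩ := hmem v hv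
    simp only [Finset.mem_coe, Finset.mem_powersetCard]
    refine ⟨fun j hj => ?_, ?_⟩
    · rw [Finset.mem_erase] at hj
      simp only [Finset.mem_filter, Finset.mem_univ, true_and, Finset.mem_singleton, forall_eq]
      exact isOrtho_active h1.1 h2 i h3 j hj.2 hj.1.symm
    · rw [Finset.card_erase_of_mem h3]
      have := card_active h1 h2
      omega
  · intro v hv w hw h
    obtain ⟨h1, h2, h3⟩ := hmem v hv
    obtain ⟨h1', h2', h3'⟩ := hmem w hw
    refine (eq_of_active_subset h1 h1'.1 (Eq.subset ?_)).symm
    rw [← Finset.insert_erase h3, ← Finset.insert_erase h3']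
    exact congrArg (insert i) h

end Polygon

section Polygon

variable {ι E : Type} [Fintype ι] [NormedAddCommGroup E] [NormedSpace ℝ E]
  [FiniteDimensional ℝ E] {P : RightAngledSystem ι E}

theorem card_active_le_two (hE : Module.finrank ℝ E = 3) {z : E} (hz : z ∈ P.ideal) :
    (P.active z).card ≤ 2 := by
  obtain ⟨F⟩ := exists_frame_of_mem_ideal hz
  have h1 : F.side.card = 1 := by
    have := F.card_side
    omega
  obtain ⟨i, hi⟩ := Finset.card_eq_one.mp h1
  refine (Finset.card_le_card (t := {i, F.opp i}) fun j hj => ?_).trans Finset.card_le_two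
  have := F.cover j (mem_active.mp hj)
  rw [hi] at this
  simp only [Finset.mem_singleton, exists_eq_left] at this
  simp only [Finset.mem_insert, Finset.mem_singleton]
  tauto

theorem not_ortho_of_ortho (hE : Module.finrank ℝ E = 3) {i j k : ι}
    (hij : P.form (P.normal i) (P.normal j) = 0) (hik : P.form (P.normal i) (P.normal k) = 0)
    (hjk : j ≠ k) : P.form (P.normal j) (P.normal k) ≠ 0 := by
  intro h
  have hne : ∀ {a b : ι}, P.form (P.normal a) (P.normal b) = 0 → a ≠ b := by
    rintro a _ h rfl
    rw [P.unit] at h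
    norm_num at h
  have hS : P.IsOrtho {i, j, k} := by
    intro a ha b hb hab
    simp only [Finset.mem_insert, Finset.mem_singleton] at ha hb
    rcases ha with ha | ha | ha <;> rcases hb with hb | hb | hb <;> rw [ha, hb] at hab ⊢ <;>
      first | exact absurd rfl hab | assumption | (rw [P.symm]; assumption)
  have h1 := hS.card_lt
  rw [Finset.card_insert_of_notMem, Finset.card_pair hjk, hE] at h1
  · omega
  · simp only [Finset.mem_insert, Finset.mem_singleton, not_or]
    exact ⟨hne hij, hne hik⟩

theorem ortho_of_link_subset {i a b : ι} (h2 : 2 ≤ Fintype.card (P.Link {i}))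
    (hsub : ∀ j, P.form (P.normal i) (P.normal j) = 0 → j = a ∨ j = b) :
    P.form (P.normal i) (P.normal a) = 0 := by
  rw [card_link] at h2
  have h3 : (Finset.univ.filter fun j => ∀ l ∈ ({i} : Finset ι),
      P.form (P.normal l) (P.normal j) = 0) ⊆ {a, b} := by
    intro j hj
    simp only [Finset.mem_filter, Finset.mem_univ, true_and, Finset.mem_singleton, forall_eq] at hj
    simpa using hsub j hj
  have h4 := Finset.eq_of_subset_of_card_le h3 (Finset.card_le_two.trans h2)
  have h5 : a ∈ ({a, b} : Finset ι) := by simp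
  rw [← h4] at h5
  simpa using h5

theorem normal_add_normal_base (i j : ι) :
    P.form P.base (P.normal i + P.normal j) < 0 := by
  rw [map_add, P.symm, P.symm P.base]
  linarith [P.base_mem i, P.base_mem j]

theorem five_le_card (P : RightAngledSystem ι E) (hE : Module.finrank ℝ E = 3) :
    5 ≤ Fintype.card ι + P.idealFinset.card := by
  by_contra! hlt
  obtain ⟨i₀⟩ := P.nonempty_index hE.ge
  have h3 : 3 ≤ Fintype.card ι := by
    have h1 := card_facet (P := P) i₀
    have h2 := two_le_card_link (P := P) hE i₀
    omega
  have hex : ∃ i, ∀ z ∈ P.ideal, P.form (P.normal i) z ≠ 0 := by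
    by_cases h : ∃ z, z ∈ P.ideal
    · obtain ⟨z, hz⟩ := h
      have h1 : ∀ w ∈ P.ideal, w = z := fun w hw =>
        Finset.card_le_one.mp (show P.idealFinset.card ≤ 1 by omega) w (mem_idealFinset.mpr hw) z
          (mem_idealFinset.mpr hz)
      have h2 : ∃ i, i ∉ P.active z := by
        by_contra! h
        have h3 := card_active_le_two hE hz
        rw [Finset.eq_univ_iff_forall.mpr h, Finset.card_univ] at h3
        omega
      obtain ⟨i, hi⟩ := h2
      exact ⟨i, fun w hw h => hi (mem_active.mpr (h1 w hw ▸ h))⟩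
    · exact ⟨i₀, fun z hz => absurd ⟨z, hz⟩ h⟩
  obtain ⟨i, hi⟩ := hex
  have hnone : ∀ i, (∀ z ∈ P.ideal, P.form (P.normal i) z ≠ 0) →
      2 ≤ Fintype.card (P.Link {i}) := by
    intro i hi
    have h1 := two_le_card_link (P := P) hE i
    rwa [Finset.filter_false_of_mem, Finset.card_empty, add_zero] at h1
    intro z hz h
    exact hi z (mem_idealFinset.mp hz) (h i (Finset.mem_singleton_self i))
  have hdeg := hnone i hi
  rw [card_link] at hdeg
  obtain ⟨j, hj, k, hk, hjk⟩ := Finset.one_lt_card.mp hdeg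
  simp only [Finset.mem_filter, Finset.mem_univ, true_and, Finset.mem_singleton, forall_eq] at hj hk
  have hjk' := not_ortho_of_ortho hE hj hk hjk
  have hij : i ≠ j := fun h => by rw [← h, P.unit] at hj; norm_num at hj
  have hik : i ≠ k := fun h => by rw [← h, P.unit] at hk; norm_num at hk
  have hcard : ({i, j, k} : Finset ι).card = 3 := by
    rw [Finset.card_insert_of_notMem (by simp [hij, hik]), Finset.card_pair hjk]
  by_cases huniv : ∀ l, l = i ∨ l = j ∨ l = k
  · have hj2 : ∃ z ∈ P.ideal, P.form (P.normal j) z = 0 := by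
      by_contra! h
      have := ortho_of_link_subset (a := k) (b := i) (hnone j h) (by
        intro l hl
        rcases huniv l with rfl | rfl | rfl
        · exact Or.inr rfl
        · rw [P.unit] at hl; norm_num at hl
        · exact Or.inl rfl)
      exact hjk' this
    obtain ⟨z, hz, hjz⟩ := hj2
    obtain ⟨l, hl, c, hc, hsum⟩ := exists_opp hz hjz
    have hiz := hi z hz
    rcases huniv l with h | h | h
    · exact hiz (h ▸ hl)
    · have := congrArg (P.form (P.normal j)) hsum
      rw [h, map_add, map_smul, hjz, P.unit] at this
      norm_num at this
    · have := congrArg (P.form (P.normal i)) hsum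
      rw [h, map_add, map_smul, hj, hk] at this
      simp [hc.ne', hiz] at this
  · push Not at huniv
    obtain ⟨l, hli, hlj, hlk⟩ := huniv
    have hcard4 : ({l, i, j, k} : Finset ι).card = 4 := by
      rw [Finset.card_insert_of_notMem (by simp [hli, hlj, hlk]), hcard]
    have h4 : 4 ≤ Fintype.card ι := hcard4 ▸ Finset.card_le_univ _
    have hall : ∀ m, m = l ∨ m = i ∨ m = j ∨ m = k := by
      have : ({l, i, j, k} : Finset ι) = Finset.univ :=
        Finset.eq_univ_of_card _ (by omega)
      intro m
      simpa [← this] using Finset.mem_univ m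
    have hideal : ∀ z, z ∉ P.ideal := by
      intro z hz
      have : 0 < P.idealFinset.card := Finset.card_pos.mpr ⟨z, mem_idealFinset.mpr hz⟩
      omega
    have hjl := ortho_of_link_subset (P := P) (i := j) (a := l) (b := i)
      (hnone j fun z hz => absurd hz (hideal z)) (by
        intro m hm
        rcases hall m with h | h | h | h
        · exact Or.inl h
        · exact Or.inr h
        · rw [h, P.unit] at hm; norm_num at hm
        · exact absurd (h ▸ hm) hjk')
    have hkl := ortho_of_link_subset (P := P) (i := k) (a := l) (b := i)
      (hnone k fun z hz => absurd hz (hideal z)) (by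
        intro m hm
        rcases hall m with h | h | h | h
        · exact Or.inl h
        · exact Or.inr h
        · rw [h, P.symm] at hm; exact absurd hm hjk'
        · rw [h, P.unit] at hm; norm_num at hm)
    have hil := not_ortho_of_ortho (P := P) (i := j) hE (by rw [P.symm]; exact hj) hjl hli.symm
    have hil' := (P.angle i l hli.symm).resolve_left hil
    have hjk'' := (P.angle j k hjk).resolve_left hjk'
    have hne : ∀ a b, P.normal a + P.normal b ≠ 0 := by
      intro a b h
      have := normal_add_normal_base (P := P) a b
      rw [h, map_zero] at this
      exact lt_irrefl _ this
    have hform : ∀ a b, P.form (P.normal a + P.normal b) (P.normal a + P.normal b) =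
        2 + 2 * P.form (P.normal a) (P.normal b) := by
      intro a b
      simp only [map_add, LinearMap.add_apply, P.unit, P.symm (P.normal b) (P.normal a)]
      ring
    obtain ⟨-, hx⟩ := eq_smul_of_causal_of_orthogonal P.form P.symm P.base P.pos
      (z := P.normal i + P.normal l) (x := P.normal j + P.normal k) (hne i l)
      (by rw [hform]; linarith)
      (by simp [hj, hk, P.symm (P.normal l), hjl, hkl]) (by rw [hform]; linarith)
    set z := P.normal i + P.normal l with hz
    set r := P.form P.base (P.normal j + P.normal k) / P.form P.base z with hr
    have hr0 : r ≠ 0 := fun h => hne j k (by rw [hx, h, zero_smul])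
    have hzz : P.form z z = 0 := by
      have : P.form z (r • z) = 0 := by
        rw [← hx]
        simp [z, hj, hk, P.symm (P.normal l), hjl, hkl]
      rw [map_smul, smul_eq_mul] at this
      exact (mul_eq_zero.mp this).resolve_left hr0
    have hil1 : P.form (P.normal i) (P.normal l) = -1 := by
      rw [hz, hform] at hzz
      linarith
    have hzcone : z ∈ P.cone := by
      intro m
      refine le_of_eq ?_
      rw [hz, map_add]
      rcases hall m with h | h | h | h <;> rw [h]
      · rw [P.unit, P.symm, hil1]; norm_num
      · rw [P.unit, hil1]; norm_num
      · rw [P.symm, hj, hjl]; norm_num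
      · rw [P.symm, hk, hkl]; norm_num
    have hb : P.form P.base z < 0 := normal_add_normal_base i l
    refine hideal ((-P.form P.base z)⁻¹ • z)
      ⟨smul_mem_cone hzcone (inv_nonneg.mpr (by linarith)), by simp [hzz], ?_⟩
    rw [map_smul, smul_eq_mul, inv_neg, neg_mul, inv_mul_cancel₀ hb.ne]

end Polygon

section FacetBounds

variable {ι E : Type} [Fintype ι] [NormedAddCommGroup E] [NormedSpace ℝ E]
  [FiniteDimensional ℝ E] {P : RightAngledSystem ι E}

variable (P) in
/-- The total number of facets and ideal vertices. -/
noncomputable def complexity : ℕ := Fintype.card ι + P.idealFinset.card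

/-- Every right-angled system of rank `d` has complexity at least `L`. -/
def ComplexityBound (d L : ℕ) : Prop :=
  ∀ {ι E : Type} [Fintype ι] [NormedAddCommGroup E] [NormedSpace ℝ E] [FiniteDimensional ℝ E]
    (Q : RightAngledSystem ι E), Module.finrank ℝ E = d → L ≤ Q.complexity

theorem le_complexity_face {d L : ℕ} (hL : ComplexityBound d L) (hd : 3 ≤ d) {S : Finset ι}
    (hS : P.IsOrtho S) (hE : Module.finrank ℝ E = S.card + d) :
    L ≤ Fintype.card (P.Link S) + (P.idealFinset.filter fun z => z ∈ P.perp S).card := by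
  have hdim : S.card + 3 ≤ Module.finrank ℝ E := by omega
  rw [← card_ideal_face hS hdim]
  refine hL (P.face hS hdim) ?_
  have := finrank_perp hS
  omega

theorem succ_le_card {d L : ℕ} (hL : ComplexityBound d L) (hd : 3 ≤ d)
    (P : RightAngledSystem ι E) (hE : Module.finrank ℝ E = d + 1) :
    L + 1 ≤ Fintype.card ι := by
  obtain ⟨i⟩ := P.nonempty_index (by omega)
  have h1 := card_facet (P := P) i
  have h2 := le_complexity_face hL hd (P.isOrtho_singleton i) (by simpa [add_comm] using hE)
  omega

theorem mul_card_orthoSets_le {d L c m : ℕ} (hL : ComplexityBound d L) (hd : 3 ≤ d)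
    (hE : Module.finrank ℝ E = m + 2) (hc : m + 2 = c + d) :
    L * (P.orthoSets c).card ≤ (P.orthoSets (c + 1)).card * (c + 1) +
      P.idealFinset.card * ∑ i ∈ Finset.range (m + 1), m.choose i * (m - i).choose (m - c) := by
  rw [← sum_card_link, ← sum_card_ideal hE (by omega), ← Finset.sum_add_distrib, mul_comm]
  refine Finset.card_nsmul_le_sum _ _ _ fun S hS => ?_
  obtain ⟨h1, h2⟩ := mem_orthoSets.mp hS
  exact le_complexity_face hL hd h1 (by omega)

theorem sum_singleton {β : Type*} [AddCommMonoid β] (g : Finset ι → β) :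
    ∑ S ∈ P.orthoSets 1, g S = ∑ i, g {i} := by
  symm
  refine Finset.sum_bij (fun i _ => {i}) ?_ ?_ ?_ fun _ _ => rfl
  · exact fun i _ => mem_orthoSets.mpr ⟨P.isOrtho_singleton i, Finset.card_singleton i⟩
  · exact fun i _ j _ h => Finset.singleton_injective h
  · intro S hS
    obtain ⟨i, hi⟩ := Finset.card_eq_one.mp (mem_orthoSets.mp hS).2
    exact ⟨i, Finset.mem_univ i, hi.symm⟩

theorem sum_card_facet_le {m : ℕ} (hE : Module.finrank ℝ E = m + 2) (hm : 1 ≤ m) :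
    Fintype.card ι + (P.orthoSets 2).card * 2 + P.idealFinset.card *
      ∑ i ∈ Finset.range (m + 1), m.choose i * (m - i).choose (m - 1) ≤
      Fintype.card ι * Fintype.card ι := by
  rw [← sum_card_ideal hE hm, ← sum_card_link 1, sum_singleton, sum_singleton]
  have h := Finset.sum_le_card_nsmul Finset.univ _ _ fun i _ => card_facet (P := P) i
  simpa [Finset.sum_add_distrib] using h

/-- Turán's bound for the number of faces of codimension two. -/
theorem mul_card_orthoSets_two_le {r : ℕ} (hE : Module.finrank ℝ E = r + 1) :
    2 * r * (P.orthoSets 2).card ≤ (r - 1) * Fintype.card ι ^ 2 := by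
  let G : SimpleGraph ι :=
    { Adj := fun i j => P.form (P.normal i) (P.normal j) = 0
      symm := ⟨fun i j h => by rw [P.symm]; exact h⟩
      loopless := ⟨fun i h => by rw [P.unit] at h; norm_num at h⟩ }
  have hG : G.CliqueFree (r + 1) := by
    intro S hS
    have h1 : P.IsOrtho S := fun i hi j hj hij => hS.1 hi hj hij
    have := h1.card_lt
    rw [hS.2] at this
    omega
  have hedges : G.edgeFinset.card = (P.orthoSets 2).card := by
    have h1 := G.sum_degrees_eq_twice_card_edges
    have h2 := sum_card_link (P := P) 1
    rw [sum_singleton, one_add_one_eq_two] at h2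
    have h3 : ∑ i, Fintype.card (P.Link {i}) = ∑ i, G.degree i := by
      refine Finset.sum_congr rfl fun i _ => ?_
      rw [card_link, ← SimpleGraph.card_neighborFinset_eq_degree]
      congr 1
      ext j
      simp [G]
    omega
  rw [← hedges]
  refine le_trans ?_ SimpleGraph.mul_card_edgeFinset_turanGraph_le
  rw [SimpleGraph.card_edgeFinset_turanGraph]
  exact Nat.mul_le_mul_left _ hG.card_edgeFinset_le

theorem two_mul_card_le {m : ℕ} (hE : Module.finrank ℝ E = m + 2) :
    2 * (P.orthoSets m).card ≤
      (m + 1) * (P.vertexFinset \ P.idealFinset).card + 2 ^ m * P.idealFinset.card := by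
  have h := sweep (P := P) hE (fun k => if k = 0 then -1 else 0) (-(m + 1)) (fun _ => -1)
    (fun u hu => by
      simp only [ite_mul, zero_mul, Finset.sum_ite_eq', Finset.mem_range, Nat.succ_pos, if_true,
        zero_add, Nat.choose_one_right]
      push_cast [hu]
      linarith)
    (fun i _ => by simp)
  simp only [ite_mul, zero_mul, Finset.sum_ite_eq', Finset.mem_range, Nat.succ_pos, if_true,
    Nat.sub_zero, ← Finset.sum_mul] at h
  have h2 : (∑ i ∈ Finset.range (m + 1), (m.choose i : ℤ)) = 2 ^ m := by
    exact_mod_cast Nat.sum_range_choose m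
  rw [h2] at h
  zify
  linarith

theorem complexityBound_three : ComplexityBound 3 5 := fun Q hE => Q.five_le_card hE

theorem complexityBound_four : ComplexityBound 4 9 := by
  intro ι E _ _ _ _ P hE
  have h1 := succ_le_card complexityBound_three le_rfl P hE
  have h2 := mul_card_orthoSets_le (P := P) (m := 2) (c := 1) complexityBound_three le_rfl hE rfl
  have h3 := two_mul_card_le (P := P) (m := 2) hE
  have h4 := sweep (P := P) (m := 2) hE (fun k => if k = 1 then 1 else if k = 2 then -2 else 0) 1
    (fun i => if i = 1 then 1 else 0) (by decide) (by decide)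
  rw [card_orthoSets_one] at h2
  simp [Finset.sum_range_succ, card_orthoSets_zero, card_orthoSets_one, Nat.choose] at h2 h3 h4
  unfold complexity
  omega

theorem complexityBound_five : ComplexityBound 5 15 := by
  intro ι E _ _ _ _ P hE
  have h1 := succ_le_card complexityBound_four (by norm_num) P hE
  have h2 := mul_card_orthoSets_le (P := P) (m := 3) (c := 2) complexityBound_three le_rfl hE rfl
  have h3 := two_mul_card_le (P := P) (m := 3) hE
  have h4 := sweep (P := P) (m := 3) hE (fun k => if k = 1 then 1 else if k = 2 then -1 else 0) 2
    (fun i => if i = 1 ∨ i = 2 then 1 else 0) (by decide) (by decide)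
  have h5 := sum_card_facet_le (P := P) (m := 3) hE (by norm_num)
  have h6 := mul_card_orthoSets_two_le (P := P) (r := 4) hE
  simp [Finset.sum_range_succ, card_orthoSets_one, Nat.choose] at h2 h3 h4 h5
  unfold complexity
  generalize Fintype.card ι = N at *
  generalize P.idealFinset.card = v at *
  by_contra! hlt
  have h7 : N ≤ 14 := by omega
  interval_cases N <;> omega

theorem complexityBound_six : ComplexityBound 6 26 := by
  intro ι E _ _ _ _ P hE
  have h1 := succ_le_card complexityBound_five (by norm_num) P hE
  have h2 := mul_card_orthoSets_le (P := P) (m := 4) (c := 3) complexityBound_three le_rfl hE rfl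
  have h3 := two_mul_card_le (P := P) (m := 4) hE
  have h4 := sweep (P := P) (m := 4) hE
    (fun k => if k = 1 then 1 else if k = 3 then -2 else if k = 4 then 4 else 0) 4
    (fun i => if i = 1 ∨ i = 3 then 1 else if i = 2 then 2 else 0) (by decide) (by decide)
  simp [Finset.sum_range_succ, card_orthoSets_zero, card_orthoSets_one, Nat.choose] at h2 h3 h4
  unfold complexity
  omega

theorem twenty_seven_mul_card_le (hE : Module.finrank ℝ E = 14) :
    27 * (P.orthoSets 7).card ≤ 8 * (P.orthoSets 8).card := by
  rw [mul_comm, mul_comm 8]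
  refine (Finset.card_nsmul_le_sum _ _ _ fun S hS => ?_).trans (sum_card_link (P := P) 7).le
  obtain ⟨h1, h2⟩ := mem_orthoSets.mp hS
  have h3 := finrank_perp h1
  exact succ_le_card complexityBound_six (by norm_num)
    (P.face h1 (by omega)) (by omega)

theorem finrank_ne_fourteen (P : RightAngledSystem ι E) : Module.finrank ℝ E ≠ 14 := by
  intro hE
  have h1 := twenty_seven_mul_card_le (P := P) hE
  let c : ℕ → ℤ := fun k => if k = 4 then -8 else if k = 5 then 27 else if k = 12 then -1 else 0
  have h2 := sweep (P := P) (m := 12) hE c 0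
    (fun i => min (∑ k ∈ Finset.range 13, c k * i.choose k)
      (∑ k ∈ Finset.range 13, c k * (12 - i).choose k))
    (by decide +kernel) (fun i _ => ⟨min_le_left _ _, min_le_right _ _⟩)
  have h3 : 0 ≤ ∑ i ∈ Finset.range 13, ((Nat.choose 12 i : ℕ) : ℤ) *
      min (∑ k ∈ Finset.range 13, c k * i.choose k)
      (∑ k ∈ Finset.range 13, c k * (12 - i).choose k) := by decide +kernel
  have h4 := h2.trans' (add_nonneg (by simp) (mul_nonneg (Int.natCast_nonneg _) h3))
  simp [Finset.sum_range_succ, card_orthoSets_zero, c] at h4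
  omega

theorem exists_ortho_card (P : RightAngledSystem ι E) :
    ∃ S, P.IsOrtho S ∧ Module.finrank ℝ E ≤ S.card + 2 := by
  obtain ⟨v, hv, -, -⟩ := exists_vertex_min (P := P) (S := ∅) (fun i hi => by simp at hi)
    (0 : E →ₗ[ℝ] ℝ)
  by_cases h : v ∈ P.ideal
  · obtain ⟨F⟩ := exists_frame_of_mem_ideal h
    exact ⟨F.side, F.ortho, F.card_side.ge⟩
  · have h1 : v ∈ P.vertexFinset \ P.idealFinset :=
      Finset.mem_sdiff.mpr ⟨mem_vertexFinset.mpr hv, fun h' => h (mem_idealFinset.mp h')⟩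
    obtain ⟨-, h2⟩ := mem_sdiff_ideal.mp h1
    exact ⟨P.active v, isOrtho_active hv.1 h2, by have := card_active hv h2; omega⟩

/-- There are no right-angled systems of large rank. -/
theorem finrank_lt_fourteen (P : RightAngledSystem ι E) : Module.finrank ℝ E < 14 := by
  by_contra! hE
  obtain ⟨S, hS, hcard⟩ := P.exists_ortho_card
  obtain ⟨T, hTS, hT⟩ := Finset.exists_subset_card_eq
    (show Module.finrank ℝ E - 14 ≤ S.card by omega)
  have hT' := hS.mono hTS
  have h1 := finrank_perp hT'
  exact (P.face hT' (by omega)).finrank_ne_fourteen (by omega)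

end FacetBounds

end RightAngledSystem

section Irredundant

variable {κ E : Type*} [AddCommGroup E] [Module ℝ E]

theorem exists_irredundant [DecidableEq κ] (f : κ → E →ₗ[ℝ] ℝ) (W : Set E) (I : Finset κ) :
    ∃ T ⊆ I, (∀ x ∈ W, (∀ k ∈ T, f k x ≤ 0) → ∀ k ∈ I, f k x ≤ 0) ∧
      ∀ j ∈ T, ∃ y ∈ W, 0 < f j y ∧ ∀ k ∈ T, k ≠ j → f k y ≤ 0 := by
  classical
  let good := I.powerset.filter fun T =>
    ∀ x ∈ W, (∀ k ∈ T, f k x ≤ 0) → ∀ k ∈ I, f k x ≤ 0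
  have hne : good.Nonempty := ⟨I, by simp [good]⟩
  obtain ⟨T, hT, hmin⟩ := good.exists_min_image Finset.card hne
  obtain ⟨hTI, hTgood⟩ := Finset.mem_filter.mp hT
  rw [Finset.mem_powerset] at hTI
  refine ⟨T, hTI, hTgood, fun j hj => ?_⟩
  by_contra! h
  have h1 : T.erase j ∈ good := by
    refine Finset.mem_filter.mpr ⟨Finset.mem_powerset.mpr ((T.erase_subset j).trans hTI), ?_⟩
    intro x hx hxT
    have hxT' : ∀ k ∈ T, k ≠ j → f k x ≤ 0 := fun k hk hkj =>
      hxT k (Finset.mem_erase.mpr ⟨hkj, hk⟩)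
    refine hTgood x hx fun k hk => ?_
    by_cases hkj : k = j
    · subst hkj
      by_contra! hpos
      obtain ⟨l, hl, hlk, hl'⟩ := h x hx hpos
      exact absurd (hxT' l hl hlk) (not_le.mpr hl')
    · exact hxT' k hk hkj
  have h2 := hmin _ h1
  have h3 := Finset.card_erase_lt_of_mem hj
  omega

theorem exists_pos_forall_add_mul_nonpos (I : Finset κ) (a b : κ → ℝ) (ha : ∀ k ∈ I, a k < 0) :
    ∃ ε : ℝ, 0 < ε ∧ ∀ k ∈ I, a k + ε * b k ≤ 0 := by
  have h : ∀ᶠ ε in nhdsWithin (0 : ℝ) (Set.Ioi 0), ∀ k ∈ I, a k + ε * b k ≤ 0 := by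
    rw [Filter.eventually_all_finset]
    intro k hk
    have hc : Continuous fun ε : ℝ => a k + ε * b k := by fun_prop
    have h0 : ∀ᶠ ε in nhds (0 : ℝ), a k + ε * b k < 0 :=
      (hc.tendsto' 0 (a k) (by simp)).eventually (eventually_lt_nhds (ha k hk))
    exact (h0.filter_mono nhdsWithin_le_nhds).mono fun _ h => h.le
  obtain ⟨ε, h1, h2⟩ := (h.and self_mem_nhdsWithin).exists
  exact ⟨ε, h2, h1⟩

end Irredundant

section AcuteAngled

variable {κ E : Type} [AddCommGroup E] [Module ℝ E] [Fintype κ] (B : E →ₗ[ℝ] E →ₗ[ℝ] ℝ)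
  (symm : ∀ x y, B x y = B y x) (p : E) (e : κ → E) (unit : ∀ i, B (e i) (e i) = 1)
  (hp : ∀ i, B (e i) p < 0)
  (right : ∀ i j, e i ≠ e j → ∀ z, B (e i) z = 0 → B (e j) z = 0 →
    (∀ d, B (e i) d = 0 → B (e j) d = 0 → ∃ ε : ℝ, 0 < ε ∧ ∀ k, B (e k) (z + ε • d) ≤ 0) →
    B (e i) (e j) = 0)

include symm unit hp right in
/-- After discarding redundant inequalities, a family of vectors that are orthogonal along the
faces of codimension two has pairwise products `0` or at most `-1`. -/
theorem exists_subfamily_angle : ∃ I : Finset κ,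
    (∀ x, (∀ k ∈ I, B (e k) x ≤ 0) → ∀ k, B (e k) x ≤ 0) ∧
      ∀ i ∈ I, ∀ j ∈ I, i ≠ j → B (e i) (e j) = 0 ∨ B (e i) (e j) ≤ -1 := by
  classical
  obtain ⟨I, -, hI, hwit⟩ := exists_irredundant (fun k => B (e k)) Set.univ Finset.univ
  have hI' : ∀ x, (∀ k ∈ I, B (e k) x ≤ 0) → ∀ k, B (e k) x ≤ 0 :=
    fun x hx k => hI x (Set.mem_univ x) hx k (Finset.mem_univ k)
  have hne : ∀ i ∈ I, ∀ j ∈ I, i ≠ j → e i ≠ e j := by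
    intro i hi j hj hij h
    obtain ⟨y, -, hy, hy'⟩ := hwit j hj
    have := hy' i hi hij
    rw [h] at this
    exact absurd this (not_le.mpr hy)
  -- a relative interior point of the intersection of two hyperplanes forces orthogonality
  have hright : ∀ i ∈ I, ∀ j ∈ I, i ≠ j → ∀ T : Finset κ,
      (∀ x, B (e i) x = 0 → B (e j) x = 0 → (∀ k ∈ T, B (e k) x ≤ 0) → ∀ k ∈ I, B (e k) x ≤ 0) →
      ∀ z, B (e i) z = 0 → B (e j) z = 0 → (∀ k ∈ T, B (e k) z < 0) → B (e i) (e j) = 0 := by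
    intro i hi j hj hij T hT z hzi hzj hz
    refine right i j (hne i hi j hj hij) z hzi hzj fun d hdi hdj => ?_
    obtain ⟨ε, hε, h⟩ := exists_pos_forall_add_mul_nonpos T (fun k => B (e k) z)
      (fun k => B (e k) d) hz
    refine ⟨ε, hε, hI' _ (hT _ ?_ ?_ fun k hk => ?_)⟩
    · simp [hzi, hdi]
    · simp [hzj, hdj]
    · simpa using h k hk
  have hnonpos : ∀ i ∈ I, ∀ j ∈ I, i ≠ j → B (e i) (e j) ≤ 0 := by
    intro i hi j hj hij
    obtain ⟨y, -, hy, hy'⟩ := hwit i hi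
    -- a relative interior point of the facet
    let q := B (e i) y • p - B (e i) p • y
    have hqi : B (e i) q = 0 := by simp [q, mul_comm]
    have hq : ∀ k ∈ I, k ≠ i → B (e k) q < 0 := by
      intro k hk hki
      simp only [q, map_sub, map_smul, smul_eq_mul]
      have h1 := mul_neg_of_pos_of_neg hy (hp k)
      have h2 := mul_nonneg_of_nonpos_of_nonpos (hp i).le (hy' k hk hki)
      linarith
    obtain ⟨T, hTI, hT, hTwit⟩ := exists_irredundant (fun k => B (e k)) {x | B (e i) x = 0}
      (I.erase i)
    have hTi : ∀ k ∈ T, k ∈ I ∧ k ≠ i := fun k hk =>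
      ⟨Finset.mem_of_mem_erase (hTI hk), Finset.ne_of_mem_erase (hTI hk)⟩
    have hTI' : ∀ x, B (e i) x = 0 → (∀ k ∈ T, B (e k) x ≤ 0) → ∀ k ∈ I, B (e k) x ≤ 0 := by
      intro x hx hxT k hk
      by_cases hki : k = i
      · rw [hki, hx]
      · exact hT x hx hxT k (Finset.mem_erase.mpr ⟨hki, hk⟩)
    have hTortho : ∀ k ∈ T, B (e i) (e k) = 0 := by
      intro k hk
      obtain ⟨hkI, hki⟩ := hTi k hk
      obtain ⟨w, hw, hwk, hw'⟩ := hTwit k hk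
      refine hright i hi k hkI hki.symm (T.erase k) ?_
        (B (e k) w • q - B (e k) q • w) ?_ ?_ ?_
      · intro x hxi hxk hx
        refine hTI' x hxi fun l hl => ?_
        by_cases hlk : l = k
        · rw [hlk, hxk]
        · exact hx l (Finset.mem_erase.mpr ⟨hlk, hl⟩)
      · have hw0 : B (e i) w = 0 := hw
        simp [hqi, hw0]
      · simp [mul_comm]
      · intro l hl
        obtain ⟨hlk, hlT⟩ := Finset.mem_erase.mp hl
        simp only [map_sub, map_smul, smul_eq_mul]
        have h1 := mul_neg_of_pos_of_neg hwk (hq l (hTi l hlT).1 (hTi l hlT).2)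
        have h2 := mul_nonneg_of_nonpos_of_nonpos (hq k hkI hki).le (hw' l hlT hlk)
        linarith
    by_cases hjT : j ∈ T
    · exact (hTortho j hjT).le
    · obtain ⟨w, -, hw, hw'⟩ := hwit j hj
      have h1 := hTI' (w - B (e i) w • e i) (by simp [unit]) (by
        intro k hk
        rw [map_sub, map_smul, symm (e k) (e i), hTortho k hk, smul_zero, sub_zero]
        exact hw' k (hTi k hk).1 fun h => hjT (h ▸ hk)) j hj
      rw [map_sub, map_smul, symm (e j) (e i), smul_eq_mul] at h1
      have h2 := hw' i hi hij
      by_contra! h3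
      have := mul_nonpos_of_nonpos_of_nonneg h2 h3.le
      linarith
  refine ⟨I, hI', fun i hi j hj hij => ?_⟩
  by_contra! h
  obtain ⟨hc0, hc1⟩ := h
  have hc := lt_of_le_of_ne (hnonpos i hi j hj hij) hc0
  set c := B (e i) (e j) with hcdef
  have hpos : 0 < 1 - c ^ 2 := by nlinarith
  have hji : B (e j) (e i) = c := symm _ _
  refine hc0 (hright i hi j hj hij ((I.erase i).erase j) ?_
    ((1 - c ^ 2) • p + (c * B (e j) p - B (e i) p) • e i + (c * B (e i) p - B (e j) p) • e j)
    ?_ ?_ ?_)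
  · intro x hxi hxj hx k hk
    by_cases hki : k = i
    · rw [hki, hxi]
    by_cases hkj : k = j
    · rw [hkj, hxj]
    exact hx k (by simp [hki, hkj, hk])
  · simp only [map_add, map_smul, smul_eq_mul, unit, ← hcdef]
    ring
  · simp only [map_add, map_smul, smul_eq_mul, unit, hji]
    ring
  · intro k hk
    simp only [Finset.mem_erase] at hk
    simp only [map_add, map_smul, smul_eq_mul]
    have h1 := mul_neg_of_pos_of_neg hpos (hp k)
    have h2 : (c * B (e j) p - B (e i) p) * B (e k) (e i) ≤ 0 :=
      mul_nonpos_of_nonneg_of_nonpos (by nlinarith [hp i, hp j]) (hnonpos k hk.2.2 i hi hk.2.1)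
    have h3 : (c * B (e i) p - B (e j) p) * B (e k) (e j) ≤ 0 :=
      mul_nonpos_of_nonneg_of_nonpos (by nlinarith [hp i, hp j]) (hnonpos k hk.2.2 j hj hk.1)
    linarith

end AcuteAngled

section Minkowski

variable {n : ℕ}

/-- The spatial part of a vector of Minkowski space. -/
noncomputable def spatial (x : Fin (n + 1) → ℝ) : EuclideanSpace ℝ (Fin n) :=
  WithLp.toLp 2 fun i => x i.succ

/-- The vector of Minkowski space with given time and space components. -/
def event (t : ℝ) (y : EuclideanSpace ℝ (Fin n)) : Fin (n + 1) → ℝ := Fin.cons t fun i => y i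

@[simp]
theorem event_zero (t : ℝ) (y : EuclideanSpace ℝ (Fin n)) : event t y 0 = t := rfl

@[simp]
theorem spatial_event (t : ℝ) (y : EuclideanSpace ℝ (Fin n)) : spatial (event t y) = y := by
  ext i
  simp [spatial, event]

theorem event_spatial (x : Fin (n + 1) → ℝ) : event (x 0) (spatial x) = x := by
  ext i
  refine Fin.cases rfl (fun i => ?_) i
  simp [spatial, event]

theorem eq_of_spatial_eq {x y : Fin (n + 1) → ℝ} (h0 : x 0 = y 0) (h : spatial x = spatial y) :
    x = y := by
  rw [← event_spatial x, ← event_spatial y, h0, h]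

@[simp]
theorem spatial_add (x y : Fin (n + 1) → ℝ) : spatial (x + y) = spatial x + spatial y := rfl

@[simp]
theorem spatial_smul (t : ℝ) (x : Fin (n + 1) → ℝ) : spatial (t • x) = t • spatial x := rfl

@[simp]
theorem spatial_zero : spatial (0 : Fin (n + 1) → ℝ) = 0 := rfl

theorem kleinMap_eq (x : Fin (n + 1) → ℝ) : kleinMap x = (x 0)⁻¹ • spatial x := by
  ext i
  simp [kleinMap, spatial, div_eq_inv_mul]

theorem mink_eq (x y : Fin (n + 1) → ℝ) :
    mink x y = -(x 0 * y 0) + inner ℝ (spatial x) (spatial y) := by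
  simp [mink, spatial, PiLp.inner_apply, mul_comm]

theorem mink_self (x : Fin (n + 1) → ℝ) : mink x x = -(x 0) ^ 2 + ‖spatial x‖ ^ 2 := by
  rw [mink_eq, real_inner_self_eq_norm_sq, sq (x 0)]

/-- The Minkowski form as a bilinear map. -/
noncomputable def minkForm (n : ℕ) : (Fin (n + 1) → ℝ) →ₗ[ℝ] (Fin (n + 1) → ℝ) →ₗ[ℝ] ℝ :=
  LinearMap.mk₂ ℝ mink
    (fun x y z => by simp only [mink_eq, spatial_add, inner_add_left, Pi.add_apply]; ring)
    (fun c x y => by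
      simp only [mink_eq, spatial_smul, real_inner_smul_left, Pi.smul_apply, smul_eq_mul]; ring)
    (fun x y z => by simp only [mink_eq, spatial_add, inner_add_right, Pi.add_apply]; ring)
    (fun c x y => by
      simp only [mink_eq, spatial_smul, real_inner_smul_right, Pi.smul_apply, smul_eq_mul]; ring)

theorem mink_comm (x y : Fin (n + 1) → ℝ) : mink x y = mink y x := by
  rw [mink_eq, mink_eq, real_inner_comm, mul_comm]

theorem mink_add_right (x y z : Fin (n + 1) → ℝ) : mink x (y + z) = mink x y + mink x z :=
  map_add (minkForm n x) y z

theorem mink_smul_right (x : Fin (n + 1) → ℝ) (t : ℝ) (y : Fin (n + 1) → ℝ) :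
    mink x (t • y) = t * mink x y :=
  map_smul (minkForm n x) t y

theorem mink_event (x : Fin (n + 1) → ℝ) (t : ℝ) (y : EuclideanSpace ℝ (Fin n)) :
    mink x (event t y) = -(x 0 * t) + inner ℝ (spatial x) y := by
  rw [mink_eq, event_zero, spatial_event]

theorem mink_pos_of_ortho {p x : Fin (n + 1) → ℝ} (hp0 : 0 < p 0) (hp : mink p p < 0)
    (hpx : mink p x = 0) (hx : x ≠ 0) : 0 < mink x x := by
  have h1 : ‖spatial p‖ < p 0 := by
    rw [mink_self] at hp
    exact lt_of_pow_lt_pow_left₀ 2 hp0.le (by linarith)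
  have h2 : p 0 * x 0 = inner ℝ (spatial p) (spatial x) := by
    rw [mink_eq] at hpx
    linarith
  have h3 : p 0 * |x 0| ≤ ‖spatial p‖ * ‖spatial x‖ := by
    have := abs_real_inner_le_norm (spatial p) (spatial x)
    rwa [← h2, abs_mul, abs_of_pos hp0] at this
  have h4 : spatial x ≠ 0 := by
    intro h
    rw [h, inner_zero_right] at h2
    exact hx (eq_of_spatial_eq (by simpa [hp0.ne'] using h2) (by simpa using h))
  have h5 : 0 < ‖spatial x‖ := norm_pos_iff.mpr h4
  have h6 : |x 0| < ‖spatial x‖ := by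
    have : p 0 * |x 0| < p 0 * ‖spatial x‖ :=
      h3.trans_lt (mul_lt_mul_of_pos_right h1 h5)
    exact lt_of_mul_lt_mul_left this hp0.le
  rw [mink_self, ← sq_abs (x 0)]
  nlinarith [abs_nonneg (x 0)]

theorem mink_neg_of_causal {p x : Fin (n + 1) → ℝ} (hp0 : 0 < p 0) (hp : mink p p < 0)
    (hx0 : 0 < x 0) (hx : mink x x ≤ 0) : mink p x < 0 := by
  have h1 : ‖spatial p‖ < p 0 := by
    rw [mink_self] at hp
    exact lt_of_pow_lt_pow_left₀ 2 hp0.le (by linarith)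
  have h2 : ‖spatial x‖ ≤ x 0 := by
    rw [mink_self] at hx
    exact le_of_pow_le_pow_left₀ two_ne_zero hx0.le (by linarith)
  rw [mink_eq]
  have h3 := real_inner_le_norm (spatial p) (spatial x)
  have h4 : ‖spatial p‖ * ‖spatial x‖ ≤ ‖spatial p‖ * x 0 :=
    mul_le_mul_of_nonneg_left h2 (norm_nonneg _)
  have h5 := mul_lt_mul_of_pos_right h1 hx0
  linarith

/-- A finite set contains no nonempty relatively open subset of a sphere. -/
theorem not_sphere_inter_subset_finite (hn : 2 ≤ n) {U s : Set (EuclideanSpace ℝ (Fin n))}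
    (hU : IsOpen U) (hs : s.Finite) (hne : (Metric.sphere 0 1 ∩ U).Nonempty) :
    ¬ Metric.sphere 0 1 ∩ U ⊆ s := by
  intro hsub
  have hfin : (Metric.sphere 0 1 ∩ U).Finite := hs.subset hsub
  have hrank : 1 < Module.rank ℝ (EuclideanSpace ℝ (Fin n)) := by
    rw [rank_eq_card_basis (EuclideanSpace.basisFun (Fin n) ℝ).toBasis, Fintype.card_fin]
    exact_mod_cast hn
  have hconn := isPreconnected_sphere hrank (0 : EuclideanSpace ℝ (Fin n)) 1
  obtain ⟨ζ, hζ, hζU⟩ := hne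
  have hinf : (Metric.sphere (0 : EuclideanSpace ℝ (Fin n)) 1).Infinite := by
    refine hconn.infinite_of_nontrivial ⟨ζ, hζ, -ζ, by simpa using hζ, fun h => ?_⟩
    have : (2 : ℝ) • ζ = 0 := by
      rw [two_smul]
      exact add_eq_zero_iff_eq_neg.mpr h
    have : ζ = 0 := (smul_eq_zero.mp this).resolve_left two_ne_zero
    rw [this] at hζ
    simp at hζ
  obtain ⟨w, hw, hwF⟩ := hinf.exists_notMem_finset hfin.toFinset
  obtain ⟨x, hx, hxU, hxF⟩ := hconn U (Metric.sphere 0 1 ∩ U)ᶜ hU hfin.isClosed.isOpen_compl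
    (fun x hx => by
      by_cases h : x ∈ U
      · exact Or.inl h
      · exact Or.inr fun h' => h h'.2)
    ⟨ζ, hζ, hζU⟩ ⟨w, hw, by simpa using hwF⟩
  exact hxF ⟨hx, hxU⟩

end Minkowski

namespace HypPolyhedron

variable {n : ℕ} {P : HypPolyhedron n}

theorem mem_image_carrier {y : EuclideanSpace ℝ (Fin n)} :
    y ∈ kleinMap '' P.carrier ↔ ‖y‖ < 1 ∧ ∀ i, mink (P.e i) (event 1 y) ≤ 0 := by
  constructor
  · rintro ⟨x, ⟨⟨hx, hx0⟩, hxe⟩, rfl⟩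
    have h1 : event 1 (kleinMap x) = (x 0)⁻¹ • x := by
      refine eq_of_spatial_eq ?_ ?_
      · simp [hx0.ne']
      · simp [kleinMap_eq]
    refine ⟨?_, fun i => ?_⟩
    · rw [mink_self] at hx
      rw [kleinMap_eq, norm_smul, norm_inv, Real.norm_of_nonneg hx0.le, inv_mul_lt_one₀ hx0]
      exact lt_of_pow_lt_pow_left₀ 2 hx0.le (by linarith)
    · rw [h1, mink_smul_right]
      exact mul_nonpos_of_nonneg_of_nonpos (inv_nonneg.mpr hx0.le) (hxe i)
  · rintro ⟨hy, hye⟩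
    have h1 : 0 < 1 - ‖y‖ ^ 2 := by nlinarith [norm_nonneg y]
    have h2 : 0 < √(1 - ‖y‖ ^ 2) := Real.sqrt_pos.mpr h1
    refine ⟨(√(1 - ‖y‖ ^ 2))⁻¹ • event 1 y, ⟨⟨?_, ?_⟩, fun i => ?_⟩, ?_⟩
    · rw [mink_self]
      simp only [Pi.smul_apply, event_zero, smul_eq_mul, mul_one, spatial_smul, spatial_event,
        norm_smul, norm_inv, Real.norm_of_nonneg h2.le, mul_pow, inv_pow, Real.sq_sqrt h1.le]
      field_simp
      ring
    · simpa using h2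
    · rw [mink_smul_right]
      exact mul_nonpos_of_nonneg_of_nonpos (inv_nonneg.mpr h2.le) (hye i)
    · rw [kleinMap_eq]
      simp [smul_smul, h2.ne']

theorem continuous_mink_event (x : Fin (n + 1) → ℝ) :
    Continuous fun y : EuclideanSpace ℝ (Fin n) => mink x (event 1 y) := by
  simp only [mink_event]
  fun_prop

theorem mink_event_combo (x : Fin (n + 1) → ℝ) (y z : EuclideanSpace ℝ (Fin n)) (t : ℝ) :
    mink x (event 1 ((1 - t) • y + t • z)) =
      (1 - t) * mink x (event 1 y) + t * mink x (event 1 z) := by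
  simp only [mink_event, inner_add_right, real_inner_smul_right]
  ring

variable (P) in
theorem exists_interior_point : ∃ y : EuclideanSpace ℝ (Fin n), ‖y‖ < 1 ∧
    ∀ i, mink (P.e i) (event 1 y) < 0 := by
  obtain ⟨y, hy⟩ := P.nonempty_int
  refine ⟨y, (mem_image_carrier.mp (interior_subset hy)).1, fun i => ?_⟩
  have hc : Continuous fun t : ℝ => y + t • spatial (P.e i) := by fun_prop
  have h1 : ∀ᶠ t in nhdsWithin (0 : ℝ) (Set.Ioi 0),
      y + t • spatial (P.e i) ∈ kleinMap '' P.carrier :=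
    ((hc.tendsto' 0 y (by simp)).eventually
      (mem_interior_iff_mem_nhds.mp hy)).filter_mono nhdsWithin_le_nhds
  obtain ⟨t, ht, ht0⟩ := (h1.and self_mem_nhdsWithin).exists
  have h2 := (mem_image_carrier.mp ht).2 i
  have h3 := P.unit i
  rw [mink_self] at h3
  rw [mink_event, inner_add_right, real_inner_smul_right, real_inner_self_eq_norm_sq] at h2
  rw [mink_event]
  have h4 : 0 < t * ‖spatial (P.e i)‖ ^ 2 := mul_pos ht0 (by nlinarith [sq_nonneg (P.e i 0)])
  linarith

theorem mem_cl {y : EuclideanSpace ℝ (Fin n)} :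
    y ∈ P.cl ↔ ‖y‖ ≤ 1 ∧ ∀ i, mink (P.e i) (event 1 y) ≤ 0 := by
  constructor
  · intro hy
    have hclosed : IsClosed {y : EuclideanSpace ℝ (Fin n) |
        ‖y‖ ≤ 1 ∧ ∀ i, mink (P.e i) (event 1 y) ≤ 0} := by
      rw [Set.ofPred_and, Set.ofPred_forall]
      refine (isClosed_le continuous_norm continuous_const).inter ?_
      exact isClosed_iInter fun i => isClosed_le (continuous_mink_event _) continuous_const
    refine closure_minimal (fun w hw => ?_) hclosed hy
    obtain ⟨h1, h2⟩ := mem_image_carrier.mp hw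
    exact ⟨h1.le, h2⟩
  · rintro ⟨hy, hye⟩
    obtain ⟨y₀, hy₀, hy₀e⟩ := P.exists_interior_point
    have hc : Continuous fun t : ℝ => (1 - t) • y + t • y₀ := by fun_prop
    refine mem_closure_of_tendsto ((hc.tendsto' 0 y (by simp)).mono_left
      (nhdsWithin_le_nhds (s := Set.Ioi 0))) ?_
    filter_upwards [Ioo_mem_nhdsGT (zero_lt_one' ℝ)] with t ht
    refine mem_image_carrier.mpr ⟨?_, fun i => ?_⟩
    · refine (norm_add_le _ _).trans_lt ?_
      rw [norm_smul, norm_smul, Real.norm_of_nonneg ht.1.le,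
        Real.norm_of_nonneg (sub_nonneg.mpr ht.2.le)]
      nlinarith [ht.1, ht.2]
    · rw [mink_event_combo]
      nlinarith [ht.1, ht.2, hye i, hy₀e i]

/-- In a polyhedron of finite volume the bounding half-spaces cut out a subset of the closed
ball. -/
theorem norm_le_one (hn : 2 ≤ n) (hP : P.FiniteVolume) {y : EuclideanSpace ℝ (Fin n)}
    (hy : ∀ i, mink (P.e i) (event 1 y) ≤ 0) : ‖y‖ ≤ 1 := by
  by_contra! hlt
  obtain ⟨y₀, hy₀, hy₀e⟩ := P.exists_interior_point
  have hc : Continuous fun t : ℝ => ‖(1 - t) • y₀ + t • y‖ := by fun_prop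
  obtain ⟨t, ht, hnorm⟩ := intermediate_value_Ioo (zero_le_one' ℝ) hc.continuousOn
    (show (1 : ℝ) ∈ Set.Ioo _ _ by simpa using ⟨hy₀, hlt⟩)
  let U : Set (EuclideanSpace ℝ (Fin n)) := {w | ∀ i, mink (P.e i) (event 1 w) < 0}
  have hU : IsOpen U := by
    have : U = ⋂ i, {w | mink (P.e i) (event 1 w) < 0} := by
      ext w
      simp [U]
    rw [this]
    exact isOpen_iInter_of_finite fun i => isOpen_lt (continuous_mink_event _) continuous_const
  refine not_sphere_inter_subset_finite hn hU hP.1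
    ⟨(1 - t) • y₀ + t • y, by simpa using hnorm, fun i => ?_⟩ ?_
  · rw [mink_event_combo]
    nlinarith [ht.1, ht.2, hy i, hy₀e i]
  · rintro w ⟨hw, hwU⟩
    refine extremePoints_convexHull_subset (𝕜 := ℝ) ?_
    rw [← hP.2]
    refine inter_extremePoints_subset_extremePoints_of_subset
      (A := Metric.closedBall 0 1) (fun v hv => by simpa using (mem_cl.mp hv).1) ⟨?_, ?_⟩
    · exact mem_cl.mpr ⟨by simpa using (mem_sphere_zero_iff_norm.mp hw).le, fun i => (hwU i).le⟩
    · exact StrictConvexSpace.sphere_subset_extremePoints_closedBall _ one_ne_zero hw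

theorem mink_self_nonpos_of_pos (hn : 2 ≤ n) (hP : P.FiniteVolume) {x : Fin (n + 1) → ℝ}
    (hx : ∀ i, mink (P.e i) x ≤ 0) (hx0 : 0 < x 0) : mink x x ≤ 0 := by
  have h1 : event 1 ((x 0)⁻¹ • spatial x) = (x 0)⁻¹ • x :=
    eq_of_spatial_eq (by simp [hx0.ne']) (by simp)
  have h2 := norm_le_one hn hP (y := (x 0)⁻¹ • spatial x) fun i => by
    rw [h1, mink_smul_right]
    exact mul_nonpos_of_nonneg_of_nonpos (inv_nonneg.mpr hx0.le) (hx i)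
  rw [norm_smul, norm_inv, Real.norm_of_nonneg hx0.le, inv_mul_le_one₀ hx0] at h2
  rw [mink_self]
  nlinarith [norm_nonneg (spatial x)]

theorem eq_zero_of_time_eq_zero (hn : 2 ≤ n) (hP : P.FiniteVolume) {x : Fin (n + 1) → ℝ}
    (hx : ∀ i, mink (P.e i) x ≤ 0) (hx0 : x 0 = 0) : x = 0 := by
  by_contra hne
  obtain ⟨y₀, -, hy₀e⟩ := P.exists_interior_point
  have hs : 0 < ‖spatial x‖ := by
    rw [norm_pos_iff]
    exact fun h => hne (eq_of_spatial_eq hx0 h)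
  have h1 := norm_le_one hn hP (y := y₀ + ((‖y₀‖ + 2) / ‖spatial x‖) • spatial x) fun i => by
    have h2 := hx i
    rw [mink_eq, hx0] at h2
    have h3 := (hy₀e i).le
    rw [mink_event] at h3 ⊢
    rw [inner_add_right, real_inner_smul_right]
    have h4 : 0 ≤ (‖y₀‖ + 2) / ‖spatial x‖ := by positivity
    nlinarith
  have h2 := norm_sub_norm_le (((‖y₀‖ + 2) / ‖spatial x‖) • spatial x) (-y₀)
  rw [norm_smul, norm_neg, sub_neg_eq_add, add_comm _ y₀, norm_div, norm_norm,
    Real.norm_of_nonneg (by positivity), div_mul_cancel₀ _ hs.ne'] at h2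
  linarith

theorem time_pos (hn : 2 ≤ n) (hP : P.FiniteVolume) {x : Fin (n + 1) → ℝ}
    (hx : ∀ i, mink (P.e i) x ≤ 0) (hne : x ≠ 0) : 0 < x 0 := by
  by_contra! hle
  rcases hle.eq_or_lt with h | h
  · exact hne (eq_zero_of_time_eq_zero hn hP hx h)
  obtain ⟨y₀, -, hy₀e⟩ := P.exists_interior_point
  have h1 : event 1 y₀ + (-x 0)⁻¹ • x = 0 := by
    refine eq_zero_of_time_eq_zero hn hP (fun i => ?_) ?_
    · rw [mink_add_right, mink_smul_right]
      exact add_nonpos (hy₀e i).le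
        (mul_nonpos_of_nonneg_of_nonpos (inv_nonneg.mpr (by linarith)) (hx i))
    · have : (-x 0)⁻¹ * x 0 = -1 := by rw [inv_neg, neg_mul, inv_mul_cancel₀ h.ne]
      simp only [Pi.add_apply, event_zero, Pi.smul_apply, smul_eq_mul, this]
      norm_num
  rcases isEmpty_or_nonempty (Fin P.m) with hm | ⟨⟨i⟩⟩
  · have h2 := eq_zero_of_time_eq_zero hn hP (fun i => hm.elim i)
      (event_zero 0 (EuclideanSpace.single (⟨0, by omega⟩ : Fin n) 1))
    have h3 := congrArg spatial h2
    rw [spatial_event, spatial_zero, PiLp.single_eq_zero_iff] at h3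
    exact one_ne_zero h3
  · have h2 := congrArg (mink (P.e i)) h1
    rw [mink_add_right, mink_smul_right] at h2
    have h3 : (-x 0)⁻¹ * mink (P.e i) x ≤ 0 :=
      mul_nonpos_of_nonneg_of_nonpos (inv_nonneg.mpr (by linarith)) (hx i)
    have h4 : mink (P.e i) 0 = 0 := map_zero (minkForm n (P.e i))
    linarith [hy₀e i]

/-- Two bounding hyperplanes of a right-angled polyhedron whose intersection with the polyhedron
has a relative interior point are orthogonal. -/
theorem mink_eq_zero_of_adjacent (hn : 2 ≤ n) (hP : P.FiniteVolume) (hR : P.IsRightAngled)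
    {i j : Fin P.m} (hij : P.e i ≠ P.e j) {z : Fin (n + 1) → ℝ} (hz0 : z ≠ 0)
    (hzi : mink (P.e i) z = 0) (hzj : mink (P.e j) z = 0)
    (hz : ∀ d, mink (P.e i) d = 0 → mink (P.e j) d = 0 →
      ∃ ε : ℝ, 0 < ε ∧ ∀ k, mink (P.e k) (z + ε • d) ≤ 0) : mink (P.e i) (P.e j) = 0 := by
  have hmem : ∀ x : Fin (n + 1) → ℝ, 0 < x 0 → (∀ k, mink (P.e k) x ≤ 0) →
      (x 0)⁻¹ • spatial x ∈ P.cl := by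
    intro x hx0 hx
    have h1 : event 1 ((x 0)⁻¹ • spatial x) = (x 0)⁻¹ • x :=
      eq_of_spatial_eq (by simp [hx0.ne']) (by simp)
    have h2 : ∀ k, mink (P.e k) (event 1 ((x 0)⁻¹ • spatial x)) ≤ 0 := fun k => by
      rw [h1, mink_smul_right]
      exact mul_nonpos_of_nonneg_of_nonpos (inv_nonneg.mpr hx0.le) (hx k)
    exact mem_cl.mpr ⟨norm_le_one hn hP h2, h2⟩
  have hzK : ∀ k, mink (P.e k) z ≤ 0 := by
    have hmz : ∀ k, mink (P.e k) 0 = 0 := fun k => map_zero (minkForm n (P.e k))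
    obtain ⟨ε, -, h⟩ := hz 0 (hmz i) (hmz j)
    simpa using h
  have hzt : 0 < z 0 := time_pos hn hP hzK hz0
  obtain ⟨y₀, -, hy₀⟩ := P.exists_interior_point
  let F : Set (EuclideanSpace ℝ (Fin n)) :=
    {y | y ∈ P.cl ∧ mink (P.e i) (event 1 y) = 0 ∧ mink (P.e j) (event 1 y) = 0}
  have hmemF : ∀ x : Fin (n + 1) → ℝ, 0 < x 0 → (∀ k, mink (P.e k) x ≤ 0) →
      mink (P.e i) x = 0 → mink (P.e j) x = 0 → (x 0)⁻¹ • spatial x ∈ F := by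
    intro x hx0 hx hxi hxj
    have h1 : event 1 ((x 0)⁻¹ • spatial x) = (x 0)⁻¹ • x :=
      eq_of_spatial_eq (by simp [hx0.ne']) (by simp)
    refine ⟨hmem x hx0 hx, ?_, ?_⟩ <;> rw [h1, mink_smul_right]
    · rw [hxi, mul_zero]
    · rw [hxj, mul_zero]
  have hζ := hmemF z hzt hzK hzi hzj
  have hexposed : IsExposed ℝ P.cl F := by
    intro _
    refine ⟨innerSL ℝ (spatial (P.e i) + spatial (P.e j)), ?_⟩
    have hval : ∀ y, innerSL ℝ (spatial (P.e i) + spatial (P.e j)) y =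
        mink (P.e i) (event 1 y) + mink (P.e j) (event 1 y) + (P.e i 0 + P.e j 0) := by
      intro y
      simp only [innerSL_apply_apply, inner_add_left, mink_event]
      ring
    ext y
    constructor
    · rintro ⟨hy, hyi, hyj⟩
      refine ⟨hy, fun w hw => ?_⟩
      rw [hval, hval, hyi, hyj]
      linarith [(mem_cl.mp hw).2 i, (mem_cl.mp hw).2 j]
    · rintro ⟨hy, hmax⟩
      have h1 := hmax _ hζ.1
      rw [hval, hval, hζ.2.1, hζ.2.2] at h1
      have h2 := (mem_cl.mp hy).2 i
      have h3 := (mem_cl.mp hy).2 j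
      exact ⟨hy, by linarith, by linarith⟩
  have hindep : LinearIndependent ℝ ![spatial (P.e i), spatial (P.e j)] := by
    rw [LinearIndependent.pair_iff]
    intro s t hst
    have h0 : s • P.e i + t • P.e j = 0 := by
      refine eq_of_spatial_eq ?_ (by simpa using hst)
      have h1 : mink (s • P.e i + t • P.e j) z = 0 := by
        rw [mink_comm, mink_add_right, mink_smul_right, mink_smul_right, mink_comm z, hzi,
          mink_comm z, hzj]
        simp
      rw [mink_eq, spatial_add, spatial_smul, spatial_smul, hst, inner_zero_left, add_zero,
        neg_eq_zero] at h1
      exact (mul_eq_zero.mp h1).resolve_right hzt.ne'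
    have hsi := congrArg (mink (P.e i)) h0
    have hsj := congrArg (mink (P.e j)) h0
    have hsp := congrArg (mink (event 1 y₀)) h0
    have hzero : ∀ x : Fin (n + 1) → ℝ, mink x 0 = 0 := fun x => map_zero (minkForm n x)
    rw [hzero, mink_add_right, mink_smul_right, mink_smul_right] at hsi hsj hsp
    rw [P.unit] at hsi hsj
    rw [mink_comm (P.e j)] at hsj
    rw [mink_comm _ (P.e i), mink_comm _ (P.e j)] at hsp
    by_cases hs : s = 0
    · refine ⟨hs, ?_⟩
      rw [hs] at hsj
      linarith
    · exfalso
      have h2 : (s + t) * (s - t) = 0 := by linear_combination s * hsi - t * hsj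
      rcases mul_eq_zero.mp h2 with h3 | h3
      · obtain rfl : t = -s := by linarith
        rw [neg_smul, ← sub_eq_add_neg, ← smul_sub] at h0
        exact hij (sub_eq_zero.mp ((smul_eq_zero.mp h0).resolve_left hs))
      · obtain rfl : t = s := by linarith
        rw [← mul_add] at hsp
        have := (mul_eq_zero.mp hsp).resolve_left hs
        linarith [hy₀ i, hy₀ j]
  have hspan : vectorSpan ℝ F =
      (Submodule.span ℝ (Set.range ![spatial (P.e i), spatial (P.e j)]))ᗮ := by
    refine le_antisymm ?_ fun d hd => ?_
    · rw [vectorSpan_def, Submodule.span_le]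
      rintro _ ⟨y, hy, w, hw, rfl⟩
      have hi := hy.2.1.trans hw.2.1.symm
      have hj := hy.2.2.trans hw.2.2.symm
      rw [mink_event, mink_event, add_right_inj] at hi hj
      have hle : Submodule.span ℝ (Set.range ![spatial (P.e i), spatial (P.e j)]) ≤
          (ℝ ∙ (y - w))ᗮ := by
        rw [Submodule.span_le]
        rintro _ ⟨k, rfl⟩
        rw [SetLike.mem_coe, Submodule.mem_orthogonal_singleton_iff_inner_left, inner_sub_right,
          sub_eq_zero]
        fin_cases k
        · exact hi
        · exact hj
      exact fun u hu => Submodule.mem_orthogonal_singleton_iff_inner_left.mp (hle hu)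
    · have hdi : mink (P.e i) (event 0 d) = 0 := by
        rw [mink_event, mul_zero, neg_zero, zero_add]
        exact hd _ (Submodule.subset_span ⟨0, rfl⟩)
      have hdj : mink (P.e j) (event 0 d) = 0 := by
        rw [mink_event, mul_zero, neg_zero, zero_add]
        exact hd _ (Submodule.subset_span ⟨1, rfl⟩)
      obtain ⟨ε, hε, h⟩ := hz _ hdi hdj
      have h0 : (z + ε • event 0 d) 0 = z 0 := by simp
      have h1 := hmemF (z + ε • event 0 d) (by rw [h0]; exact hzt) h
        (by rw [mink_add_right, mink_smul_right, hzi, hdi, mul_zero, add_zero])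
        (by rw [mink_add_right, mink_smul_right, hzj, hdj, mul_zero, add_zero])
      have h2 := vsub_mem_vectorSpan ℝ h1 hζ
      rw [h0, vsub_eq_sub, ← smul_sub, spatial_add, add_sub_cancel_left, spatial_smul,
        spatial_event] at h2
      rw [Submodule.smul_mem_iff _ (inv_ne_zero hzt.ne'), Submodule.smul_mem_iff _ hε.ne'] at h2
      exact h2
  have hdim : sdim F = n - 2 := by
    rw [sdim, hspan]
    have h1 := Submodule.finrank_add_finrank_orthogonal
      (Submodule.span ℝ (Set.range ![spatial (P.e i), spatial (P.e j)]))
    rw [finrank_span_eq_card hindep, finrank_euclideanSpace_fin, Fintype.card_fin] at h1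
    omega
  have hklein : ∀ x ∈ P.carrier, ∀ e, mink e (event 1 (kleinMap x)) = 0 → mink e x = 0 := by
    intro x hx e h
    have hx0 := hx.1.2
    have h1 : event 1 (kleinMap x) = (x 0)⁻¹ • x :=
      eq_of_spatial_eq (by simp [hx0.ne']) (by simp [kleinMap_eq])
    rw [h1, mink_smul_right] at h
    exact (mul_eq_zero.mp h).resolve_left (inv_ne_zero hx0.ne')
  exact hR i j (fun h => hij (congrArg P.e h)) ⟨F, ⟨hexposed, ⟨_, hζ⟩, hdim⟩,
    fun x hx h => hklein x hx _ h.2.1, fun x hx h => hklein x hx _ h.2.2⟩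

/-- The right-angled system carried by a right-angled polyhedron of finite volume. -/
theorem exists_rightAngledSystem (hn : 2 ≤ n) (hP : P.FiniteVolume) (hR : P.IsRightAngled) :
    ∃ I : Finset (Fin P.m), Nonempty (RightAngledSystem I (Fin (n + 1) → ℝ)) := by
  obtain ⟨y₀, hy₀, hy₀e⟩ := P.exists_interior_point
  have hp : mink (event 1 y₀) (event 1 y₀) < 0 := by
    rw [mink_self, event_zero, spatial_event]
    nlinarith [norm_nonneg y₀]
  obtain ⟨I, hI, hangle⟩ := exists_subfamily_angle (minkForm n) mink_comm (event 1 y₀) P.e P.unit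
    hy₀e (by
      intro i j hij z hzi hzj hz
      refine mink_eq_zero_of_adjacent hn hP hR hij ?_ hzi hzj hz
      rintro rfl
      have hlt : Module.finrank ℝ (ℝ × ℝ) < Module.finrank ℝ (Fin (n + 1) → ℝ) := by
        rw [Module.finrank_prod, Module.finrank_self, Module.finrank_fin_fun]
        omega
      obtain ⟨d, hd, hne⟩ := Submodule.exists_mem_ne_zero_of_ne_bot
        (LinearMap.ker_ne_bot_of_finrank_lt
          (f := (minkForm n (P.e i)).prod (minkForm n (P.e j))) hlt)
      obtain ⟨hdi, hdj⟩ := Prod.mk.inj (LinearMap.mem_ker.mp hd)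
      have hpos : ∀ v : Fin (n + 1) → ℝ, v ≠ 0 → mink (P.e i) v = 0 → mink (P.e j) v = 0 →
          0 < v 0 := by
        intro v hv hvi hvj
        obtain ⟨ε, hε, h⟩ := hz v hvi hvj
        have h1 := time_pos hn hP h (by simpa [hε.ne'] using hv)
        simpa [hε] using h1
      have h1 := hpos d hne hdi hdj
      have h2 := hpos (-d) (neg_ne_zero.mpr hne)
        ((map_neg (minkForm n (P.e i)) d).trans (neg_eq_zero.mpr hdi))
        ((map_neg (minkForm n (P.e j)) d).trans (neg_eq_zero.mpr hdj))
      rw [Pi.neg_apply] at h2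
      linarith)
  refine ⟨I, ⟨⟨minkForm n, mink_comm, event 1 y₀, fun i => P.e i, hp,
    fun x => mink_pos_of_ortho one_pos hp, fun i => P.unit i,
    fun i j hij => hangle i i.2 j j.2 fun h => hij (Subtype.ext h), fun i => hy₀e i,
    fun x hx => ?_, fun x hx hne => ?_⟩⟩⟩
  · have hx' := hI x fun k hk => hx ⟨k, hk⟩
    by_cases hne : x = 0
    · rw [hne, map_zero]
    · exact mink_self_nonpos_of_pos hn hP hx' (time_pos hn hP hx' hne)
  · have hx' := hI x fun k hk => hx ⟨k, hk⟩
    have h0 := time_pos hn hP hx' hne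
    exact mink_neg_of_causal one_pos hp h0 (mink_self_nonpos_of_pos hn hP hx' h0)

end HypPolyhedron

/-- There are no finite-volume right-angled convex hyperbolic polyhedra in `ℍⁿ` for `n ≥ 13`. -/
theorem no_finite_volume_right_angled_polyhedron (n : ℕ) (hn : 13 ≤ n) :
    ¬ ∃ P : HypPolyhedron n, P.IsRightAngled ∧ P.FiniteVolume := by
  rintro ⟨P, hR, hP⟩
  obtain ⟨I, ⟨Q⟩⟩ := P.exists_rightAngledSystem (by omega) hP hR
  have := Q.finrank_lt_fourteen
  rw [Module.finrank_fin_fun] at this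
  omega
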